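/- arXiv:1508.04202 — 5 statements merged into one kernel-verified Lean document; each statement's English description precedes it below -/
import Mathlib

section
/- Let m, N be positive integers and let B(v,w) = Σ_{i=1}^m vᵢwᵢ be the standard symmetric bilinear form on ℂ^m. Let f : (ℂ^m)^N → ℂ be a multilinear map such that f(g·v₁, …, g·v_N) = f(v₁, …, v_N) for every g in the orthogonal group O(m,ℂ) = {g ∈ GL_m(ℂ) : gᵀg = 1} and all v₁, …, v_N ∈ ℂ^m. If N is odd then f = 0; if N is even, then f lies in the ℂ-linear span of the multilinear maps (v₁, …, v_N) ↦ ∏_{i=1}^{N/2} B(v_{σ(2i−1)}, v_{σ(2i)}), where σ ranges over the permutations of {1, …, N}. -/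
open scoped Matrix

namespace OrthogonalFFT

open Finset

variable {ι n : Type*} [Fintype ι] [DecidableEq ι] [Fintype n]

/-- The action of a matrix on the coordinates of a tensor (equivalently, of a multilinear form). -/
def tensorAction (g : Matrix n n ℂ) (F : (ι → n) → ℂ) (I : ι → n) : ℂ :=
  ∑ J : ι → n, (∏ i, g (J i) (I i)) * F J

theorem tensorAction_sub (g : Matrix n n ℂ) (F G : (ι → n) → ℂ) :
    tensorAction g (F - G) = tensorAction g F - tensorAction g G := by
  ext I
  simp [tensorAction, mul_sub, Finset.sum_sub_distrib]

theorem tensorAction_sum_smul {α : Type*} (s : Finset α) (c : α → ℂ) (g : Matrix n n ℂ)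
    (G : α → (ι → n) → ℂ) :
    tensorAction g (∑ x ∈ s, c x • G x) = ∑ x ∈ s, c x • tensorAction g (G x) := by
  ext I
  simp only [tensorAction, Finset.sum_apply, Pi.smul_apply, smul_eq_mul, Finset.mul_sum]
  rw [Finset.sum_comm]
  exact Finset.sum_congr rfl fun _ _ => Finset.sum_congr rfl fun _ _ => by ring

theorem sum_norm_sq_eq (F : (ι → n) → ℂ) :
    ((∑ I, ‖F I‖ ^ 2 : ℝ) : ℂ) = ∑ I, star (F I) * F I := by
  push_cast
  exact Finset.sum_congr rfl fun I _ => (Complex.conj_mul' (F I)).symm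

theorem tensorAction_reindex (σ : Equiv.Perm ι) (g : Matrix n n ℂ) (F : (ι → n) → ℂ) :
    tensorAction g (fun I => F (I ∘ σ)) = fun I => tensorAction g F (I ∘ σ) := by
  ext I
  refine Fintype.sum_equiv (σ.symm.arrowCongr (Equiv.refl n)) _ _ fun J => ?_
  congr 1
  exact (Equiv.prod_comp σ fun i => g (J i) (I i)).symm

theorem sum_fin_cons {N : ℕ} (f : (Fin (N + 1) → n) → ℂ) :
    ∑ J, f J = ∑ a, ∑ J, f (Fin.cons a J) := by
  rw [← Fintype.sum_prod_type']
  exact (Fintype.sum_equiv (Fin.consEquiv fun _ => n) _ _ fun _ => rfl).symm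

/-- Contraction of the first two slots of a tensor. -/
def contractFirst {N : ℕ} (F : (Fin (N + 2) → n) → ℂ) (J : Fin N → n) : ℂ :=
  ∑ a, F (Fin.cons a (Fin.cons a J))

variable [DecidableEq n]

/-- Invariance of a tensor under the complex orthogonal group. -/
def IsOrthInvariant (F : (ι → n) → ℂ) : Prop :=
  ∀ g : Matrix n n ℂ, gᵀ * g = 1 → tensorAction g F = F

/-- The action of the elementary matrix `E_ab` of the general linear Lie algebra on tensors. -/
def elemAction (a b : n) (F : (ι → n) → ℂ) (I : ι → n) : ℂ :=
  ∑ i, if I i = a then F (Function.update I i b) else 0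

/-- All contractions of two distinct slots of the tensor vanish. -/
def IsTraceless (F : (ι → n) → ℂ) : Prop :=
  ∀ (i j : ι), i ≠ j → ∀ I : ι → n,
    ∑ b, F (Function.update (Function.update I i b) j b) = 0

theorem tensorAction_diagonal (d : n → ℂ) (F : (ι → n) → ℂ) (I : ι → n) :
    tensorAction (Matrix.diagonal d) F I = (∏ i, d (I i)) * F I := by
  unfold tensorAction
  rw [Finset.sum_eq_single I]
  · simp
  · intro J _ hJ
    obtain ⟨i, hi⟩ := Function.ne_iff.mp hJ
    rw [Finset.prod_eq_zero (mem_univ i) (by exact Matrix.diagonal_apply_ne _ hi), zero_mul]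
  · simp

theorem tensorAction_one (F : (ι → n) → ℂ) : tensorAction 1 F = F := by
  ext I
  rw [← Matrix.diagonal_one, tensorAction_diagonal]
  simp

/-- Sign changes of a coordinate force every index value to occur an even number of times. -/
theorem IsOrthInvariant.even_card {F : (ι → n) → ℂ} (hF : IsOrthInvariant F) {I : ι → n}
    (hI : F I ≠ 0) (a : n) : Even #{i | I i = a} := by
  have h := congrFun (hF (Matrix.diagonal fun c => if c = a then -1 else 1) (by
    rw [Matrix.diagonal_transpose, Matrix.diagonal_mul_diagonal, ← Matrix.diagonal_one]
    congr 1
    ext c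
    split_ifs <;> simp)) I
  rw [tensorAction_diagonal, Finset.prod_ite] at h
  simp only [prod_const, one_pow, mul_one] at h
  by_contra hodd
  rw [Nat.not_even_iff_odd] at hodd
  rw [hodd.neg_one_pow] at h
  apply hI
  linear_combination (-1 / 2 : ℂ) * h

open scoped Matrix.Norms.Operator in
theorem hasDerivAt_exp_smul_apply (A : Matrix n n ℂ) (a b : n) :
    HasDerivAt (fun t : ℂ => NormedSpace.exp (t • A) a b) (A a b) 0 := by
  have h := hasDerivAt_exp_smul_const (𝕂 := ℂ) A 0
  simp only [zero_smul, NormedSpace.exp_zero, one_mul] at h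
  exact hasDerivAt_pi.mp (hasDerivAt_pi.mp h a) b

theorem transpose_exp_mul_exp_of_transpose_eq_neg {A : Matrix n n ℂ} (hA : Aᵀ = -A) :
    (NormedSpace.exp A)ᵀ * NormedSpace.exp A = 1 := by
  rw [← Matrix.exp_transpose, hA, ← Matrix.exp_add_of_commute _ _ (Commute.refl A).neg_left]
  simp

theorem sum_prod_erase_one_mul (A : Matrix n n ℂ) (F : (ι → n) → ℂ) (I : ι → n) (i : ι) :
    ∑ J : ι → n, ((∏ j ∈ univ.erase i, (1 : Matrix n n ℂ) (J j) (I j)) * A (J i) (I i)) * F J =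
      ∑ c, A c (I i) * F (Function.update I i c) := by
  symm
  apply Finset.sum_of_injOn (fun c => Function.update I i c)
  · intro c _ d _ h
    simpa using congrFun h i
  · simp
  · intro J _ hJ
    have : ∃ j, j ≠ i ∧ J j ≠ I j := by
      by_contra! h
      apply hJ
      refine ⟨J i, by simp, ?_⟩
      ext j
      by_cases hj : j = i
      · subst hj; simp
      · simp [hj, h j hj]
    obtain ⟨j, hj, hne⟩ := this
    rw [Finset.prod_eq_zero (mem_erase.mpr ⟨hj, mem_univ j⟩)
      (by exact Matrix.one_apply_ne hne)]
    simp
  · intro c _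
    rw [Finset.prod_eq_one]
    · simp
    · intro j hj
      rw [Function.update_of_ne (Finset.ne_of_mem_erase hj)]
      exact Matrix.one_apply_eq _

theorem IsOrthInvariant.sum_sum_eq_zero {F : (ι → n) → ℂ} (hF : IsOrthInvariant F)
    {A : Matrix n n ℂ} (hA : Aᵀ = -A) (I : ι → n) :
    ∑ i, ∑ c, A c (I i) * F (Function.update I i c) = 0 := by
  have h₁ : HasDerivAt (fun t : ℂ => tensorAction (NormedSpace.exp (t • A)) F I)
      (∑ J : ι → n, (∑ i, (∏ j ∈ univ.erase i, NormedSpace.exp ((0 : ℂ) • A) (J j) (I j)) •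
        A (J i) (I i)) * F J) 0 := by
    unfold tensorAction
    refine HasDerivAt.fun_sum fun J _ => HasDerivAt.mul_const ?_ _
    exact HasDerivAt.fun_finsetProd fun i _ => hasDerivAt_exp_smul_apply A _ _
  have h₂ : (fun t : ℂ => tensorAction (NormedSpace.exp (t • A)) F I) = fun _ => F I := by
    ext t
    rw [hF _ (transpose_exp_mul_exp_of_transpose_eq_neg (by simp [hA]))]
  rw [h₂] at h₁
  have h := h₁.unique (hasDerivAt_const _ _)
  simp only [zero_smul, NormedSpace.exp_zero, smul_eq_mul, Finset.sum_mul] at h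
  rw [Finset.sum_comm] at h
  simpa only [sum_prod_erase_one_mul] using h

theorem IsOrthInvariant.elemAction_comm {F : (ι → n) → ℂ} (hF : IsOrthInvariant F) (a b : n) :
    elemAction a b F = elemAction b a F := by
  ext I
  have h := hF.sum_sum_eq_zero (A := Matrix.single b a 1 - Matrix.single a b 1) (by simp) I
  rw [← sub_eq_zero, ← h]
  unfold elemAction
  rw [← Finset.sum_sub_distrib]
  refine Finset.sum_congr rfl fun i _ => ?_
  simp [Matrix.single_apply, sub_mul, Finset.sum_sub_distrib, ite_and, eq_comm]

theorem elemAction_self {n : Type*} [DecidableEq n] (a : n) (F : (ι → n) → ℂ) (I : ι → n) :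
    elemAction a a F I = #{i | I i = a} * F I := by
  unfold elemAction
  rw [← Finset.sum_filter, Finset.sum_congr rfl (g := fun _ => F I), Finset.sum_const, nsmul_eq_mul]
  intro i hi
  rw [← (Finset.mem_filter.mp hi).2, Function.update_eq_self]

theorem IsTraceless.sum_elemAction_elemAction {F : (ι → n) → ℂ} (hF : IsTraceless F) (I : ι → n) :
    ∑ a, ∑ b, elemAction a b (elemAction a b F) I = Fintype.card ι * F I := by
  have key (a : n) (i : ι) : (∑ b, if I i = a then elemAction a b F (Function.update I i b) else 0)
      = if I i = a then F I else 0 := by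
    split_ifs with hi
    · unfold elemAction
      rw [Finset.sum_comm, Finset.sum_eq_single i]
      · simp [← hi]
      · intro j _ hj
        simp only [Function.update_of_ne hj]
        split_ifs
        · exact hF i j hj.symm I
        · simp
      · simp
    · simp
  calc _ = ∑ a, ∑ i, if I i = a then F I else 0 := by
        refine Finset.sum_congr rfl fun a _ => ?_
        rw [← Finset.sum_congr rfl fun i _ => key a i, Finset.sum_comm]
        rfl
    _ = _ := by
        rw [Finset.sum_comm]
        simp

theorem sum_star_mul_elemAction (a b : n) (F G : (ι → n) → ℂ) :
    ∑ I, star (G I) * elemAction a b F I = ∑ I, star (elemAction b a G I) * F I := by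
  simp only [elemAction, Finset.mul_sum, star_sum, Finset.sum_mul]
  rw [Finset.sum_comm, Finset.sum_comm (s := univ (α := ι → n))]
  refine Finset.sum_congr rfl fun i _ => ?_
  simp only [mul_ite, mul_zero, apply_ite star, star_zero, ite_mul, zero_mul]
  rw [← Finset.sum_filter, ← Finset.sum_filter]
  refine Finset.sum_nbij' (fun I => Function.update I i b) (fun I => Function.update I i a)
    (by simp) (by simp) ?_ ?_ ?_
  · intro I hI
    simp [← (Finset.mem_filter.mp hI).2]
  · intro I hI
    simp [← (Finset.mem_filter.mp hI).2]
  · intro I hI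
    simp [← (Finset.mem_filter.mp hI).2]

/-- A traceless tensor in positive degree that is invariant under the orthogonal group vanishes. -/
theorem IsOrthInvariant.eq_zero_of_isTraceless [Nonempty ι] {F : (ι → n) → ℂ}
    (hF : IsOrthInvariant F) (hF' : IsTraceless F) : F = 0 := by
  have h₁ : ∑ a, ∑ b, ∑ I, ‖elemAction a b F I‖ ^ 2 = Fintype.card ι * ∑ I, ‖F I‖ ^ 2 := by
    apply Complex.ofReal_injective
    rw [Complex.ofReal_mul, sum_norm_sq_eq]
    push_cast
    simp only [Finset.mul_sum]
    calc _ = ∑ a, ∑ b, ∑ I, star (F I) * elemAction a b (elemAction a b F) I := by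
          refine Finset.sum_congr rfl fun a _ => Finset.sum_congr rfl fun b _ => ?_
          rw [sum_star_mul_elemAction, hF.elemAction_comm b a, ← sum_norm_sq_eq]
          push_cast
          rfl
      _ = ∑ I, star (F I) * ∑ a, ∑ b, elemAction a b (elemAction a b F) I := by
          simp only [Finset.mul_sum]
          rw [Finset.sum_comm (s := univ (α := ι → n))]
          refine Finset.sum_congr rfl fun a _ => ?_
          rw [Finset.sum_comm]
      _ = _ := by
          refine Finset.sum_congr rfl fun I _ => ?_
          rw [hF'.sum_elemAction_elemAction]
          ring
  have h₂ : ∑ a, ∑ I, ‖elemAction a a F I‖ ^ 2 ≤ ∑ a, ∑ b, ∑ I, ‖elemAction a b F I‖ ^ 2 :=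
    Finset.sum_le_sum fun a _ => Finset.single_le_sum
      (f := fun b => ∑ I, ‖elemAction a b F I‖ ^ 2) (fun b _ => by positivity) (mem_univ a)
  have h₃ : 2 * (Fintype.card ι * ∑ I, ‖F I‖ ^ 2) ≤ ∑ a, ∑ I, ‖elemAction a a F I‖ ^ 2 := by
    rw [Finset.sum_comm, Finset.mul_sum, Finset.mul_sum]
    refine Finset.sum_le_sum fun I _ => ?_
    by_cases hI : F I = 0
    · simp [hI, elemAction_self]
    have hcard : (Fintype.card ι : ℝ) = ∑ a, (#{i | I i = a} : ℝ) := by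
      have := Finset.card_eq_sum_card_fiberwise (s := univ) (t := univ) (f := I) (by simp)
      rw [Finset.card_univ] at this
      exact_mod_cast this
    rw [hcard, Finset.sum_mul, Finset.mul_sum]
    refine Finset.sum_le_sum fun a _ => ?_
    rw [elemAction_self, norm_mul, mul_pow, Complex.norm_natCast, ← mul_assoc]
    refine mul_le_mul_of_nonneg_right ?_ (by positivity)
    obtain ⟨k, hk⟩ := hF.even_card hI a
    rw [hk]
    have : 2 * (k + k) ≤ (k + k) ^ 2 := by rcases k with _ | k <;> nlinarith
    exact_mod_cast this
  have hpos : (0 : ℝ) < Fintype.card ι := by exact_mod_cast Fintype.card_pos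
  have h₄ : ∑ I, ‖F I‖ ^ 2 = 0 := by
    have h0 : 0 ≤ ∑ I, ‖F I‖ ^ 2 := by positivity
    nlinarith
  ext I
  simpa using (Finset.sum_eq_zero_iff_of_nonneg (fun I _ => by positivity)).mp h₄ I (mem_univ I)

theorem IsOrthInvariant.reindex {F : (ι → n) → ℂ} (hF : IsOrthInvariant F) (σ : Equiv.Perm ι) :
    IsOrthInvariant fun I => F (I ∘ σ) := fun g hg => by
  rw [tensorAction_reindex, hF g hg]

theorem IsOrthInvariant.contractFirst {N : ℕ} {F : (Fin (N + 2) → n) → ℂ}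
    (hF : IsOrthInvariant F) : IsOrthInvariant (contractFirst F) := fun g hg => by
  ext I
  have hg' (b c : n) : ∑ a, g b a * g c a = if b = c then 1 else 0 := by
    rw [← Matrix.one_apply, ← mul_eq_one_comm.mp hg]
    rfl
  symm
  calc OrthogonalFFT.contractFirst F I
      = ∑ a, tensorAction g F (Fin.cons a (Fin.cons a I)) := by
        rw [hF g hg]; rfl
    _ = ∑ a, ∑ b, ∑ c, ∑ J : Fin N → n, (g b a * g c a) *
          ((∏ i, g (J i) (I i)) * F (Fin.cons b (Fin.cons c J))) := by
        simp only [tensorAction, sum_fin_cons, Fin.prod_univ_succ, Fin.cons_zero, Fin.cons_succ,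
          mul_assoc]
    _ = ∑ b, ∑ c, ∑ J : Fin N → n, (∑ a, g b a * g c a) *
          ((∏ i, g (J i) (I i)) * F (Fin.cons b (Fin.cons c J))) := by
        simp only [Finset.sum_mul]
        rw [Finset.sum_comm]
        refine Finset.sum_congr rfl fun b _ => ?_
        rw [Finset.sum_comm]
        exact Finset.sum_congr rfl fun c _ => Finset.sum_comm
    _ = _ := by
        simp only [hg', ite_mul, one_mul, zero_mul, tensorAction, OrthogonalFFT.contractFirst,
          Finset.mul_sum]
        rw [Finset.sum_comm (s := univ (α := Fin N → n))]
        refine Finset.sum_congr rfl fun b _ => ?_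
        rw [Finset.sum_comm]
        simp

/-- The map sending both `2 * k` and `2 * k + 1` to `k`. -/
def half {M : ℕ} (i : Fin (2 * M)) : Fin M := ⟨i / 2, by omega⟩

theorem half_zero {M : ℕ} : half (M := M + 1) (0 : Fin (2 * M + 2)) = 0 := by
  ext; simp [half]

theorem half_one {M : ℕ} : half (M := M + 1) (1 : Fin (2 * M + 2)) = 0 := by
  ext; change 1 % (2 * M + 2) / 2 = 0; rw [Nat.mod_eq_of_lt (by omega)]

theorem half_succ_succ {M : ℕ} (l : Fin (2 * M)) :
    half (M := M + 1) (l.succ.succ : Fin (2 * M + 2)) = (half l).succ := by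
  ext; change (l.val + 1 + 1) / 2 = l.val / 2 + 1; omega

theorem exists_perm_apply_eq_zero_one {N : ℕ} {i j : Fin (N + 2)} (hij : i ≠ j) :
    ∃ σ : Equiv.Perm (Fin (N + 2)), σ i = 0 ∧ σ j = 1 := by
  refine ⟨(Equiv.swap i 0).trans (Equiv.swap (Equiv.swap i 0 j) 1), ?_, by simp⟩
  rw [Equiv.trans_apply, Equiv.swap_apply_left]
  refine Equiv.swap_apply_of_ne_of_ne ?_ (by simp)
  exact fun h => hij ((Equiv.swap i 0).injective ((Equiv.swap_apply_left i 0).trans h))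

/-- An orthogonally invariant tensor orthogonal to all perfect matchings vanishes. -/
theorem IsOrthInvariant.eq_zero_of_sum_matching_eq_zero {M : ℕ} {F : (Fin (2 * M) → n) → ℂ}
    (hF : IsOrthInvariant F)
    (h : ∀ σ : Equiv.Perm (Fin (2 * M)), ∑ K : Fin M → n, F (fun i => K (half (σ i))) = 0) :
    F = 0 := by
  induction M with
  | zero =>
    ext I
    have : IsEmpty (Fin (2 * 0)) := Fin.isEmpty
    have h' := h 1
    rw [Fintype.sum_unique] at h'
    exact (congrArg F (Subsingleton.elim _ _)).trans h'
  | succ M ih =>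
    have : Nonempty (Fin (2 * (M + 1))) := ⟨⟨0, by omega⟩⟩
    refine hF.eq_zero_of_isTraceless fun i j hij I => ?_
    obtain ⟨σ, hi, hj⟩ := exists_perm_apply_eq_zero_one (N := 2 * M) hij
    have hG := ih (F := OrthogonalFFT.contractFirst (N := 2 * M) fun I => F (I ∘ σ))
      (hF.reindex σ).contractFirst fun τ => by
        let τ' : Equiv.Perm (Fin (2 * M + 2)) :=
          Equiv.Perm.decomposeFin.symm (0, Equiv.Perm.decomposeFin.symm (0, τ))
        have h' := h (σ.trans τ')
        rw [sum_fin_cons, Finset.sum_comm] at h'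
        rw [← h']
        refine Finset.sum_congr rfl fun K _ => Finset.sum_congr rfl fun a _ => congrArg F ?_
        ext k
        simp only [Function.comp_apply, Equiv.trans_apply]
        generalize σ k = l
        refine Fin.cases ?_ (fun l => Fin.cases ?_ (fun l => ?_) l) l
        · simp [τ', half_zero]
        · simp [τ', half_one]
        · simp [τ', half_succ_succ]
    have := congrFun hG fun k => I (σ.symm k.succ.succ)
    rw [Pi.zero_apply] at this
    rw [← this]
    refine Finset.sum_congr rfl fun a _ => congrArg F ?_
    ext k
    obtain ⟨l, rfl⟩ := σ.symm.surjective k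
    rw [← Equiv.eq_symm_apply] at hi hj
    subst hi hj
    simp only [Function.update_apply, EmbeddingLike.apply_eq_iff_eq, Function.comp_apply,
      Equiv.apply_symm_apply]
    refine Fin.cases ?_ (fun l => Fin.cases ?_ (fun l => ?_) l) l
    · simp
    · simp
    · simp [Fin.ext_iff]

/-- The coordinates of the product of the standard bilinear form over the pairs
`(σ (2 * k), σ (2 * k + 1))`. -/
def matchingTensor {M : ℕ} (σ : Equiv.Perm (Fin (2 * M))) (I : Fin (2 * M) → n) : ℂ :=
  ∑ K : Fin M → n, if I = fun i => K (half (σ.symm i)) then 1 else 0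

theorem prod_fin_two_mul {M : ℕ} (f : Fin (2 * M) → ℂ) :
    ∏ i, f i = ∏ k : Fin M, f ⟨2 * k, by omega⟩ * f ⟨2 * k + 1, by omega⟩ := by
  rw [← Equiv.prod_comp (finProdFinEquiv.trans (finCongr (mul_comm M 2))), Fintype.prod_prod_type]
  refine Finset.prod_congr rfl fun k _ => ?_
  rw [Fin.prod_univ_two]
  congr 2 <;> ext <;> simp [add_comm]

theorem sum_mul_matchingTensor {M : ℕ} (σ : Equiv.Perm (Fin (2 * M)))
    (f : (Fin (2 * M) → n) → ℂ) :
    ∑ I, f I * matchingTensor σ I = ∑ K : Fin M → n, f fun i => K (half (σ.symm i)) := by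
  simp only [matchingTensor, Finset.mul_sum]
  rw [Finset.sum_comm]
  simp

theorem sum_prod_mul_matchingTensor {M : ℕ} (σ : Equiv.Perm (Fin (2 * M)))
    (v : Fin (2 * M) → n → ℂ) :
    ∑ I : Fin (2 * M) → n, (∏ i, v i (I i)) * matchingTensor σ I =
      ∏ k : Fin M, ∑ j, v (σ ⟨2 * k, by omega⟩) j * v (σ ⟨2 * k + 1, by omega⟩) j := by
  rw [sum_mul_matchingTensor, Finset.prod_univ_sum, Fintype.piFinset_univ]
  refine Finset.sum_congr rfl fun K _ => ?_
  rw [← Equiv.prod_comp σ, prod_fin_two_mul]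
  refine Finset.prod_congr rfl fun k _ => ?_
  have h₀ : half (M := M) ⟨2 * k, by omega⟩ = k := by ext; simp [half]
  have h₁ : half (M := M) ⟨2 * k + 1, by omega⟩ = k := by ext; simp [half]; omega
  simp only [Equiv.symm_apply_apply, h₀, h₁]

theorem isOrthInvariant_matchingTensor {M : ℕ} (σ : Equiv.Perm (Fin (2 * M))) :
    IsOrthInvariant (matchingTensor (n := n) σ) := fun g hg => by
  conv_rhs => rw [← tensorAction_one (matchingTensor σ)]
  have hg' (b c : n) : ∑ a, g a b * g a c = ∑ a, (1 : Matrix n n ℂ) a b * (1 : Matrix n n ℂ) a c := by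
    have h : gᵀ * g = (1 : Matrix n n ℂ)ᵀ * (1 : Matrix n n ℂ) := by simp [hg]
    exact congrFun (congrFun h b) c
  ext I
  unfold tensorAction
  rw [sum_prod_mul_matchingTensor σ fun i j => g j (I i),
    sum_prod_mul_matchingTensor σ fun i j => (1 : Matrix n n ℂ) j (I i)]
  simp only [hg']

/-- Every orthogonally invariant tensor is a linear combination of perfect matchings. -/
theorem IsOrthInvariant.exists_eq_sum_matchingTensor {M : ℕ} {F : (Fin (2 * M) → n) → ℂ}
    (hF : IsOrthInvariant F) :
    ∃ c : Equiv.Perm (Fin (2 * M)) → ℂ, F = ∑ σ, c σ • matchingTensor σ := by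
  let W : Submodule ℂ (EuclideanSpace ℂ (Fin (2 * M) → n)) :=
    Submodule.span ℂ (Set.range fun σ => WithLp.toLp 2 (matchingTensor σ))
  obtain ⟨w, hw, z, hz, hwz⟩ := W.exists_add_mem_mem_orthogonal (WithLp.toLp 2 F)
  obtain ⟨c, rfl⟩ := (Submodule.mem_span_range_iff_exists_fun ℂ).mp hw
  refine ⟨c, ?_⟩
  have hz' : z.ofLp = F - ∑ σ, c σ • matchingTensor σ := by
    rw [eq_sub_iff_add_eq', ← WithLp.ofLp_toLp 2 F, hwz]
    simp
  have hinv : IsOrthInvariant z.ofLp := fun g hg => by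
    rw [hz', tensorAction_sub, tensorAction_sum_smul, hF g hg]
    simp only [isOrthInvariant_matchingTensor _ g hg]
  rw [← sub_eq_zero, ← hz']
  refine hinv.eq_zero_of_sum_matching_eq_zero fun σ => ?_
  have h := (Submodule.mem_orthogonal W z).mp hz _ (Submodule.subset_span ⟨σ.symm, rfl⟩)
  rw [PiLp.inner_apply] at h
  refine ((sum_mul_matchingTensor σ.symm z.ofLp).symm.trans ?_).trans h
  refine Finset.sum_congr rfl fun I _ => ?_
  simp [matchingTensor]

theorem multilinearMap_apply_eq_sum (f : MultilinearMap ℂ (fun _ : ι => n → ℂ) ℂ) (v : ι → n → ℂ) :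
    f v = ∑ I : ι → n, (∏ i, v i (I i)) * f fun i => Pi.single (I i) 1 := by
  have hv : v = fun i => ∑ j, v i j • (Pi.single j 1 : n → ℂ) := by
    ext i j
    simp [Pi.single_apply]
  conv_lhs => rw [hv]
  rw [f.map_sum]
  simp only [f.map_smul_univ, smul_eq_mul]

theorem isOrthInvariant_coordinates {f : MultilinearMap ℂ (fun _ : ι => n → ℂ) ℂ}
    (hf : ∀ g : Matrix n n ℂ, gᵀ * g = 1 → ∀ v : ι → n → ℂ, f (fun i => g.mulVec (v i)) = f v) :
    IsOrthInvariant fun I : ι → n => f fun i => Pi.single (I i) 1 := fun g hg => by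
  ext I
  rw [← hf g hg fun i => Pi.single (I i) 1, multilinearMap_apply_eq_sum f]
  simp [tensorAction]

end OrthogonalFFT

/-- The first fundamental theorem for the orthogonal group `O(m, ℂ)` (the purely even
case of the FFT for the orthosymplectic supergroup): an `O(m,ℂ)`-invariant multilinear
form on `N` copies of `ℂ^m` vanishes if `N` is odd, and if `N = 2M` it is a linear
combination of products of the standard bilinear form `B(v,w) = Σᵢ vᵢwᵢ` evaluated on the
pairs of a perfect matching of the arguments. -/
theorem fft_orthogonal_group (m N : ℕ) (hm : 0 < m) (hN : 0 < N)
    (f : MultilinearMap ℂ (fun _ : Fin N => (Fin m → ℂ)) ℂ)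
    (hf : ∀ g : Matrix (Fin m) (Fin m) ℂ, gᵀ * g = 1 →
      ∀ v : Fin N → Fin m → ℂ, f (fun i => g.mulVec (v i)) = f v) :
    (Odd N → f = 0) ∧
    (∀ (M : ℕ) (hM : N = 2 * M), ∃ c : Equiv.Perm (Fin N) → ℂ,
      ∀ v : Fin N → Fin m → ℂ,
        f v = ∑ σ : Equiv.Perm (Fin N), c σ *
          ∏ i : Fin M,
            ∑ j : Fin m,
              v (σ ⟨2 * i.val, by have := i.isLt; omega⟩) j *
                v (σ ⟨2 * i.val + 1, by have := i.isLt; omega⟩) j) := by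
  refine ⟨fun hodd => ?_, ?_⟩
  · refine MultilinearMap.ext fun v => ?_
    have h := hf (-1) (by simp) v
    have h' := f.map_smul_univ (fun _ => (-1 : ℂ)) v
    simp only [Matrix.neg_mulVec, Matrix.one_mulVec] at h
    simp only [neg_smul, one_smul, h, Finset.prod_const, Finset.card_univ, Fintype.card_fin,
      hodd.neg_one_pow] at h'
    rw [_root_.zero_apply]
    linear_combination (1 / 2 : ℂ) * h'
  · rintro M rfl
    obtain ⟨c, hc⟩ :=
      (OrthogonalFFT.isOrthInvariant_coordinates hf).exists_eq_sum_matchingTensor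
    refine ⟨c, fun v => ?_⟩
    rw [OrthogonalFFT.multilinearMap_apply_eq_sum f]
    simp only [fun I => congrFun hc I, Finset.sum_apply, Pi.smul_apply, smul_eq_mul,
      Finset.mul_sum]
    rw [Finset.sum_comm]
    refine Finset.sum_congr rfl fun σ _ => ?_
    rw [← OrthogonalFFT.sum_prod_mul_matchingTensor σ v, Finset.mul_sum]
    exact Finset.sum_congr rfl fun I _ => by ring
end

section
/- Let n, N be positive integers and let ω(v,w) = Σ_{i=1}^n (vᵢ w_{n+i} − v_{n+i} wᵢ) be the standard symplectic form on ℂ^{2n}. Let f : (ℂ^{2n})^N → ℂ be a multilinear map such that f(g·v₁, …, g·v_N) = f(v₁, …, v_N) for every g in the symplectic group Sp(2n,ℂ) = {g ∈ GL_{2n}(ℂ) : ω(gv, gw) = ω(v,w) for all v, w} and all v₁, …, v_N ∈ ℂ^{2n}. If N is odd then f = 0; if N is even, then f lies in the ℂ-linear span of the multilinear maps (v₁, …, v_N) ↦ ∏_{i=1}^{N/2} ω(v_{σ(2i−1)}, v_{σ(2i)}), where σ ranges over the permutations of {1, …, N}. -/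
/-- The standard symplectic form `ω(v,w) = Σ_{i=1}^n (vᵢ w_{n+i} − v_{n+i} wᵢ)` on `ℂ^{2n}`. -/
noncomputable def stdSymplecticForm (n : ℕ) (v w : Fin (2 * n) → ℂ) : ℂ :=
  ∑ i : Fin n,
    (v ⟨i.val, by have := i.isLt; omega⟩ * w ⟨n + i.val, by have := i.isLt; omega⟩ -
      v ⟨n + i.val, by have := i.isLt; omega⟩ * w ⟨i.val, by have := i.isLt; omega⟩)

open Function Equiv in
/-- On an ordered pair of distinct positions, the transposition operator is a sum over matrix
units `E_ab` of the operators acting by `E_ba` on one position and by `E_ab` on the other. -/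
theorem sum_update_mul_update_of_ne {ι κ R : Type*} [Fintype ι] [DecidableEq ι] [Fintype κ]
    [DecidableEq κ] [CommSemiring R] (F H : (ι → κ) → R) {i j : ι} (hij : i ≠ j) :
    ∑ a, ∑ s : ι → κ, (if s i = s j then F (update s i a) * H (update s j a) else 0) =
      ∑ s, H s * F (fun k => s (swap i j k)) := by
  rw [← Fintype.sum_prod_type', ← Finset.sum_filter]
  refine Finset.sum_nbij' (fun p => update p.2 j p.1) (fun s => (s j, update s j (s i)))
    ?_ ?_ ?_ ?_ ?_
  · simp
  · simp [hij]
  · rintro ⟨a, s⟩ hs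
    simp only [Finset.mem_filter, Finset.mem_univ, true_and] at hs
    simp [hij, hs]
  · simp
  · rintro ⟨a, s⟩ hs
    simp only [Finset.mem_filter, Finset.mem_univ, true_and] at hs
    rw [mul_comm]
    congr 2
    ext k
    rcases eq_or_ne k i with rfl | hi
    · simp
    rcases eq_or_ne k j with rfl | hj
    · simp [hi, hij, hs]
    · simp [hi, hj, swap_apply_of_ne_of_ne hi hj]

open Function in
theorem sum_sum_update {ι κ R : Type*} [Fintype ι] [DecidableEq ι] [Fintype κ]
    [CommSemiring R] [DecidableEq κ] (F : (ι → κ) → R) (i : ι) :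
    ∑ a, ∑ s : ι → κ, F (update s i a) = Fintype.card κ * ∑ s, F s := by
  rw [← nsmul_eq_mul, ← Finset.card_univ, ← Finset.sum_const, ← Fintype.sum_prod_type',
    ← Fintype.sum_prod_type']
  refine Finset.sum_nbij' (fun p => (p.2 i, update p.2 i p.1))
    (fun p => (p.2 i, update p.2 i p.1)) ?_ ?_ ?_ ?_ ?_ <;> simp

open Function Equiv ComplexConjugate in
/-- The `gl`-Casimir operator is the Gram operator of the matrix units. -/
theorem sum_normSq_matrixUnit {ι κ : Type*} [Fintype ι] [DecidableEq ι] [Fintype κ]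
    [DecidableEq κ] (F : (ι → κ) → ℂ) :
    ∑ b, ∑ a, ∑ s : ι → κ,
        (Complex.normSq (∑ i, if s i = b then F (update s i a) else 0) : ℂ) =
      ∑ s, conj (F s) * ∑ i, ∑ j,
        (if i = j then Fintype.card κ * F s else F (fun k => s (swap i j k))) := by
  have hpair (i j : ι) : ∑ a, ∑ s : ι → κ,
      (if s i = s j then F (update s i a) * conj (F (update s j a)) else 0) =
      ∑ s, conj (F s) * (if i = j then Fintype.card κ * F s
        else F (fun k => s (swap i j k))) := by
    split_ifs with hij
    · subst hij
      simp only [if_true]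
      rw [sum_sum_update (fun s => F s * conj (F s)) i, Finset.mul_sum]
      exact Finset.sum_congr rfl fun s _ => by ring
    · exact sum_update_mul_update_of_ne F (fun s => conj (F s)) hij
  simp only [Finset.mul_sum]
  rw [Finset.sum_comm]
  conv_rhs => rw [Finset.sum_comm]; enter [2, i]; rw [Finset.sum_comm]; enter [2, j]; rw [← hpair]
  have (a : κ) (s : ι → κ) :
      ∑ b, (Complex.normSq (∑ i, if s i = b then F (update s i a) else 0) : ℂ) =
      ∑ i, ∑ j, if s i = s j then F (update s i a) * conj (F (update s j a)) else 0 := by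
    simp only [← Complex.mul_conj, map_sum, Finset.sum_mul_sum]
    rw [Finset.sum_comm]
    refine Finset.sum_congr rfl fun i _ => ?_
    rw [Finset.sum_comm]
    refine Finset.sum_congr rfl fun j _ => ?_
    simp only [ite_mul, zero_mul, Finset.sum_ite_eq, Finset.mem_univ, if_true]
    by_cases hs : s i = s j
    · simp [hs]
    · simp [hs, Ne.symm hs]
  have h (a : κ) : ∑ b, ∑ s : ι → κ,
      (Complex.normSq (∑ i, if s i = b then F (update s i a) else 0) : ℂ) =
      ∑ i, ∑ j, ∑ s : ι → κ,
        if s i = s j then F (update s i a) * conj (F (update s j a)) else 0 := by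
    rw [Finset.sum_comm]
    simp only [this]
    rw [Finset.sum_comm]
    exact Finset.sum_congr rfl fun i _ => Finset.sum_comm
  simp only [h]
  rw [Finset.sum_comm]
  exact Finset.sum_congr rfl fun i _ => Finset.sum_comm

open Equiv ComplexConjugate in
/-- The operator `card κ • card ι + ∑ i, ∑ j, swap i j` on tensors is injective, because it is
the sum of the positive semidefinite `gl`-Casimir operator and of `card ι`. -/
theorem eq_zero_of_sum_swap_eq_zero {ι κ : Type*} [Fintype ι] [DecidableEq ι] [Fintype κ]
    [DecidableEq κ] [Nonempty ι] (F : (ι → κ) → ℂ)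
    (hF : ∀ s, ∑ i, (Fintype.card κ * F s + ∑ j, F (fun k => s (swap i j k))) = 0) : F = 0 := by
  have hs (s : ι → κ) : ∑ i, ∑ j,
      (if i = j then Fintype.card κ * F s else F (fun k => s (swap i j k))) =
      -(Fintype.card ι * F s) := by
    have hcard : Fintype.card ι * F s = ∑ _i : ι, F s := by simp
    rw [eq_neg_iff_add_eq_zero, ← hF s, hcard, ← Finset.sum_add_distrib]
    refine Finset.sum_congr rfl fun i _ => ?_
    rw [← Finset.add_sum_erase _ _ (Finset.mem_univ i),
      ← Finset.add_sum_erase _ (fun j => F fun k => s (swap i j k)) (Finset.mem_univ i),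
      Finset.sum_congr rfl fun j hj => if_neg (Finset.ne_of_mem_erase hj).symm]
    simp
    ring
  have key := sum_normSq_matrixUnit F
  simp only [hs] at key
  have hneg : ∑ s, conj (F s) * -(Fintype.card ι * F s) =
      ((-(Fintype.card ι * ∑ s, Complex.normSq (F s)) : ℝ) : ℂ) := by
    push_cast
    rw [Finset.mul_sum, ← Finset.sum_neg_distrib]
    exact Finset.sum_congr rfl fun s _ => by rw [← Complex.mul_conj]; ring
  rw [hneg] at key
  norm_cast at key
  have h0 : ∑ s, Complex.normSq (F s) ≤ 0 := by
    have hpos : (0 : ℝ) < Fintype.card ι := by exact_mod_cast Fintype.card_pos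
    have hle : 0 ≤ -(Fintype.card ι * ∑ s, Complex.normSq (F s)) := by
      rw [← key]
      exact Finset.sum_nonneg fun _ _ => Finset.sum_nonneg fun _ _ =>
        Finset.sum_nonneg fun _ _ => Complex.normSq_nonneg _
    by_contra! h
    nlinarith [mul_pos hpos h]
  ext s
  have := (Finset.sum_eq_zero_iff_of_nonneg fun s _ => Complex.normSq_nonneg (F s)).1
    (h0.antisymm (Finset.sum_nonneg fun s _ => Complex.normSq_nonneg (F s))) s (Finset.mem_univ s)
  simpa using this

namespace MultilinearMap

open Equiv in
theorem eq_zero_of_sum_swap_eq_zero {ι κ V : Type*} [Fintype ι] [DecidableEq ι] [Fintype κ]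
    [Nonempty ι] [AddCommGroup V] [Module ℂ V] (b : Module.Basis κ ℂ V)
    (f : MultilinearMap ℂ (fun _ : ι => V) ℂ)
    (hf : ∀ v, ∑ i, (Fintype.card κ * f v + ∑ j, f (fun k => v (swap i j k))) = 0) : f = 0 := by
  classical
  refine Module.Basis.ext_multilinear (fun _ => b) fun s => ?_
  exact congrFun (_root_.eq_zero_of_sum_swap_eq_zero (fun s : ι → κ => f fun i => b (s i))
    fun s => hf fun i => b (s i)) s

open Function Polynomial in
/-- If a multilinear map is constant on an affine line, then its derivative along it vanishes. -/
theorem sum_update_eq_zero_of_forall_add_smul {ι K V : Type*} [Fintype ι] [DecidableEq ι] [Field K]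
    [Infinite K] [AddCommGroup V] [Module K V] (f : MultilinearMap K (fun _ : ι => V) K)
    (v w : ι → V) (h : ∀ t : K, f (fun i => v i + t • w i) = f v) :
    ∑ i, f (update v i (w i)) = 0 := by
  have hp : ∑ s : Finset ι, C (f (s.piecewise w v)) * X ^ s.card = C (f v) := by
    refine Polynomial.funext fun t => ?_
    rw [eval_C, ← h t, eval_finsetSum]
    have : (fun i => v i + t • w i) = (fun i => t • w i) + v := by
      ext1 i
      simp [add_comm]
    rw [this, map_add_univ]
    refine Finset.sum_congr rfl fun s _ => ?_
    have hs := f.map_piecewise_smul (fun _ => t) (s.piecewise w v) s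
    have he : s.piecewise (fun i => t • s.piecewise w v i) (s.piecewise w v) =
        s.piecewise (fun i => t • w i) v := by
      ext1 i
      by_cases hi : i ∈ s <;> simp [hi]
    rw [he] at hs
    rw [hs, Finset.prod_const, smul_eq_mul, eval_mul, eval_C, eval_pow, eval_X, mul_comm]
  have hc := congrArg (fun p => p.coeff 1) hp
  simp only [finsetSum_coeff, coeff_C_mul, coeff_X_pow, coeff_C, one_ne_zero, if_false, mul_ite,
    mul_one, mul_zero] at hc
  rw [← Finset.sum_filter] at hc
  have : Finset.univ.filter (fun s : Finset ι => 1 = s.card) =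
      Finset.univ.map ⟨fun i : ι => {i}, Finset.singleton_injective⟩ := by
    ext s
    rw [Finset.mem_filter, eq_comm, Finset.card_eq_one]
    simp only [Finset.mem_map, Finset.mem_univ, true_and, Embedding.coeFn_mk]
    exact exists_congr fun _ => eq_comm
  rw [this, Finset.sum_map] at hc
  simpa [Finset.piecewise_singleton] using hc

open Function Equiv
open LinearMap (BilinForm)

section Contraction

variable {ι κ V : Type*} [DecidableEq ι] [Fintype κ] [AddCommGroup V] [Module ℂ V]

/-- The contraction `∑ a, f (…, b a, …, d a, …)` of the arguments `i` and `j` of `f`. -/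
noncomputable def contractPair (b d : κ → V) (f : MultilinearMap ℂ (fun _ : ι => V) ℂ) (i j : ι) :
    MultilinearMap ℂ (fun _ : {k // k ≠ i ∧ k ≠ j} => V) ℂ :=
  ∑ a, f.domDomRestrict (fun k => k ≠ i ∧ k ≠ j) fun k => if k.1 = i then b a else d a

theorem contractPair_restrict (b d : κ → V) (f : MultilinearMap ℂ (fun _ : ι => V) ℂ) {i j : ι}
    (v : ι → V) :
    contractPair b d f i j (fun k => v k) = ∑ a, f (update (update v j (d a)) i (b a)) := by
  rw [contractPair, sum_apply]
  refine Finset.sum_congr rfl fun a _ => ?_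
  rw [domDomRestrict_apply]
  congr 1
  ext1 k
  by_cases hi : k = i
  · subst hi; simp
  by_cases hj : k = j
  · subst hj; simp [hi]
  · simp [hi, hj]

variable [DecidableEq κ] {ω : BilinForm ℂ V}

theorem sum_apply_mul_update_dualBasis (hω : ω.Nondegenerate) (b : Module.Basis κ ℂ V)
    (f : MultilinearMap ℂ (fun _ : ι => V) ℂ) (v : ι → V) (i : ι) (x : V) :
    ∑ a, ω x (b a) * f (update v i (ω.dualBasis hω b a)) = f (update v i x) := by
  conv_rhs => rw [← (ω.dualBasis hω b).sum_repr x, map_update_sum]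
  simp

theorem sum_dualBasis_apply_mul_update (hω : ω.Nondegenerate) (b : Module.Basis κ ℂ V)
    (f : MultilinearMap ℂ (fun _ : ι => V) ℂ) (v : ι → V) (i : ι) (x : V) :
    ∑ a, ω (ω.dualBasis hω b a) x * f (update v i (b a)) = f (update v i x) := by
  have (a : κ) : ω (ω.dualBasis hω b a) x = b.repr x a := by
    conv_lhs => rw [← b.sum_repr x]
    simp only [_root_.map_sum, map_smul, smul_eq_mul, BilinForm.apply_dualBasis_left]
    simp
  conv_rhs => rw [← b.sum_repr x, map_update_sum]
  simp [this]

variable [Fintype ι]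

/-- Invariance of a multilinear form under the endomorphisms `v ↦ ω x v • x`, which span the
Lie algebra of the symplectic group of `ω`. -/
def IsSpInvariant (ω : BilinForm ℂ V) (f : MultilinearMap ℂ (fun _ : ι => V) ℂ) : Prop :=
  ∀ x v, ∑ j, ω x (v j) * f (update v j x) = 0

theorem IsSpInvariant.polarize {f : MultilinearMap ℂ (fun _ : ι => V) ℂ}
    (hf : IsSpInvariant ω f) (x y : V) (v : ι → V) :
    ∑ j, (ω x (v j) * f (update v j y) + ω y (v j) * f (update v j x)) = 0 := by
  have h := hf (x + y) v
  simp only [map_add, LinearMap.add_apply, MultilinearMap.map_update_add, add_mul, mul_add,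
    Finset.sum_add_distrib, hf x v, hf y v] at h ⊢
  linear_combination h

theorem IsSpInvariant.contract (hω : ω.Nondegenerate) (halt : ω.IsAlt)
    (b : Module.Basis κ ℂ V) {f : MultilinearMap ℂ (fun _ : ι => V) ℂ}
    (hf : IsSpInvariant ω f) {i j : ι} (hij : i ≠ j) :
    IsSpInvariant ω (contractPair b (ω.dualBasis hω b) f i j) := by
  intro x w
  obtain ⟨v, rfl⟩ : ∃ v : ι → V, w = fun k : {k // k ≠ i ∧ k ≠ j} => v k :=
    ⟨fun k => if h : k ≠ i ∧ k ≠ j then w ⟨k, h⟩ else 0, by ext1 k; simp [k.2]⟩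
  set d := ω.dualBasis hω b
  have hup (k : {k // k ≠ i ∧ k ≠ j}) :
      contractPair b d f i j (update (fun l : {k // k ≠ i ∧ k ≠ j} => v l) k x) =
        ∑ a, f (update (update (update v j (d a)) i (b a)) k x) := by
    have : update (fun l : {k // k ≠ i ∧ k ≠ j} => v l) k x =
        fun l : {k // k ≠ i ∧ k ≠ j} => update v (k : ι) x l := by
      ext1 l
      simp [update_apply, Subtype.ext_iff]
    rw [this, contractPair_restrict]
    refine Finset.sum_congr rfl fun a _ => ?_
    rw [update_comm k.2.2, update_comm k.2.1]
  have hsplit (g : ι → ℂ) : ∑ k, g k = ∑ k : {k // k ≠ i ∧ k ≠ j}, g k + (g i + g j) := by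
    rw [← Finset.sum_pair hij, ← Finset.sum_add_sum_compl {i, j} g, add_comm,
      Finset.sum_subtype _ (p := fun k => k ≠ i ∧ k ≠ j) (by simp)]
  have hinv : ∑ a, ∑ k, ω x (update (update v j (d a)) i (b a) k) *
      f (update (update (update v j (d a)) i (b a)) k x) = 0 :=
    Finset.sum_eq_zero fun a _ => hf x _
  have hne (a : κ) (k : {k // k ≠ i ∧ k ≠ j}) :
      update (update v j (d a)) i (b a) k = v k := by simp [k.2.1, k.2.2]
  have hi : ∑ a, ω x (b a) * f (update (update v j (d a)) i x) = f (update (update v j x) i x) := by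
    simp only [update_comm hij.symm]
    exact sum_apply_mul_update_dualBasis hω b f _ j x
  have hj : ∑ a, ω x (d a) * f (update (update v i (b a)) j x) =
      -f (update (update v j x) i x) := by
    have hx (a : κ) : ω x (d a) = -ω (d a) x := (LinearMap.IsAlt.neg halt _ _).symm
    simp only [hx, neg_mul, Finset.sum_neg_distrib, update_comm hij]
    rw [sum_dualBasis_apply_mul_update]
  have hcomm (a : κ) : update (update (update v j (d a)) i (b a)) j x =
      update (update v i (b a)) j x := by
    rw [update_comm hij.symm, update_idem]
  simp only [hsplit, hne, hcomm, Finset.sum_add_distrib, update_self, update_idem,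
    update_of_ne hij.symm, hi, hj] at hinv
  rw [Finset.sum_comm] at hinv
  simp only [hup, Finset.mul_sum]
  linear_combination hinv

theorem IsSpInvariant.casimir (hω : ω.Nondegenerate) (halt : ω.IsAlt)
    (b : Module.Basis κ ℂ V) {f : MultilinearMap ℂ (fun _ : ι => V) ℂ}
    (hf : IsSpInvariant ω f) (i : ι) (v : ι → V) :
    Fintype.card κ * f v + ∑ j, f (fun k => v (swap i j k)) =
      -∑ j, ω (v i) (v j) * contractPair b (ω.dualBasis hω b) f i j (fun k => v k) := by
  set d := ω.dualBasis hω b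
  simp only [contractPair_restrict]
  have h : ∑ a, ∑ j, (ω (v i) (update v i (b a) j) * f (update (update v i (b a)) j (d a)) +
      ω (d a) (update v i (b a) j) * f (update (update v i (b a)) j (v i))) = 0 :=
    Finset.sum_eq_zero fun a _ => hf.polarize (v i) (d a) (update v i (b a))
  rw [Finset.sum_comm] at h
  have hj (j : ι) : ∑ a, (ω (v i) (update v i (b a) j) * f (update (update v i (b a)) j (d a)) +
      ω (d a) (update v i (b a) j) * f (update (update v i (b a)) j (v i))) =
      ω (v i) (v j) * ∑ a, f (update (update v j (d a)) i (b a)) + f (fun k => v (swap i j k)) +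
        if i = j then Fintype.card κ * f v else 0 := by
    rw [Finset.sum_add_distrib]
    split_ifs with hij
    · subst hij
      have hd (a : κ) : ω (d a) (b a) = 1 := by simp [d, BilinForm.apply_dualBasis_left]
      simp [halt (v i), hd, d, sum_apply_mul_update_dualBasis]
    · have hji := Ne.symm hij
      simp only [update_of_ne hji, ← Finset.mul_sum, add_zero]
      congr 1
      · simp only [update_comm hij]
      · simp only [update_comm hij]
        rw [sum_dualBasis_apply_mul_update]
        congr 1
        ext1 k
        by_cases hi : k = i
        · subst hi; simp
        by_cases hj : k = j
        · subst hj; simp [hi]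
        · simp [hi, hj, swap_apply_of_ne_of_ne hi hj]
  simp only [hj, Finset.sum_add_distrib, Finset.sum_ite_eq, Finset.mem_univ, if_true] at h
  linear_combination h

end Contraction

section Matching

variable {ι κ V : Type*} [AddCommGroup V] [Module ℂ V]

/-- The product of the values of `ω` on the pairs of the perfect matching `e` of the arguments. -/
def matchingProd (ω : BilinForm ℂ V) {M : ℕ} (e : Fin M × Fin 2 ≃ ι) (v : ι → V) : ℂ :=
  ∏ k, ω (v (e (k, 0))) (v (e (k, 1)))

/-- The linear combinations of products of `ω` over perfect matchings of the arguments. -/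
def matchingSpan (ω : BilinForm ℂ V) (ι : Type*) (M : ℕ) :
    Submodule ℂ (MultilinearMap ℂ (fun _ : ι => V) ℂ) :=
  (Submodule.span ℂ (Set.range (matchingProd (ι := ι) (M := M) ω))).comap
    ({ toFun := fun f => f
       map_add' := fun _ _ => rfl
       map_smul' := fun _ _ => rfl } :
      MultilinearMap ℂ (fun _ : ι => V) ℂ →ₗ[ℂ] (ι → V) → ℂ)

theorem mem_matchingSpan {ω : BilinForm ℂ V} {M : ℕ} {f : MultilinearMap ℂ (fun _ : ι => V) ℂ} :
    f ∈ matchingSpan ω ι M ↔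
      (f : (ι → V) → ℂ) ∈ Submodule.span ℂ (Set.range (matchingProd (ι := ι) (M := M) ω)) :=
  Iff.rfl

theorem domDomCongr_mem_matchingSpan {ω : BilinForm ℂ V} {M : ℕ}
    {f : MultilinearMap ℂ (fun _ : ι => V) ℂ} (hf : f ∈ matchingSpan ω ι M) (σ : Perm ι) :
    f.domDomCongr σ ∈ matchingSpan ω ι M := by
  rw [mem_matchingSpan] at hf ⊢
  let T : ((ι → V) → ℂ) →ₗ[ℂ] ((ι → V) → ℂ) := LinearMap.funLeft ℂ ℂ fun v k => v (σ k)
  have hle : Submodule.span ℂ (Set.range (matchingProd (ι := ι) (M := M) ω)) ≤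
      (Submodule.span ℂ (Set.range (matchingProd (ι := ι) (M := M) ω))).comap T := by
    rw [Submodule.span_le]
    rintro _ ⟨e, rfl⟩
    exact Submodule.subset_span ⟨e.trans σ, rfl⟩
  exact hle hf

variable [Fintype ι]

/-- Adding the pair `(i, j)` to a matching of the remaining arguments. -/
theorem exists_matchingProd_eq_mul (ω : BilinForm ℂ V) {M : ℕ} {i j : ι} (hij : i ≠ j)
    (hcard : Fintype.card ι = 2 * (M + 1)) (e : Fin M × Fin 2 ≃ {k // k ≠ i ∧ k ≠ j}) :
    ∃ e' : Fin (M + 1) × Fin 2 ≃ ι, ∀ v,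
      matchingProd ω e' v = ω (v i) (v j) * matchingProd ω e fun k => v k := by
  let g : Fin (M + 1) × Fin 2 → ι := fun p =>
    Fin.cons (α := fun _ => ι) (![i, j] p.2) (fun k => (e (k, p.2) : ι)) p.1
  have hne (p : Fin M × Fin 2) (x : Fin 2) : (e p : ι) ≠ ![i, j] x := by
    fin_cases x
    · exact (e p).2.1
    · exact (e p).2.2
  have hg : Injective g := by
    rintro ⟨k, x⟩ ⟨l, y⟩
    refine Fin.cases ?_ (fun k => ?_) k <;> refine Fin.cases ?_ (fun l => ?_) l <;> intro h
    · have : ![i, j] x = ![i, j] y := h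
      fin_cases x <;> fin_cases y <;> simp_all
    · exact absurd h.symm (hne (l, y) x)
    · exact absurd h (hne (k, x) y)
    · have : (k, x) = (l, y) := e.injective (Subtype.ext h)
      simp_all
  refine ⟨Equiv.ofBijective g ((Fintype.bijective_iff_injective_and_card g).2
    ⟨hg, by simp [hcard, mul_comm]⟩), fun v => ?_⟩
  rw [matchingProd, Fin.prod_univ_succ]
  rfl

theorem mul_mem_span_matchingProd {ω : BilinForm ℂ V} {M : ℕ} {i j : ι} (hij : i ≠ j)
    (hcard : Fintype.card ι = 2 * (M + 1))
    {f : MultilinearMap ℂ (fun _ : {k // k ≠ i ∧ k ≠ j} => V) ℂ}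
    (hf : f ∈ matchingSpan ω {k // k ≠ i ∧ k ≠ j} M) :
    (fun v : ι → V => ω (v i) (v j) * f fun k => v k) ∈
      Submodule.span ℂ (Set.range (matchingProd (ι := ι) (M := M + 1) ω)) := by
  let T : (({k // k ≠ i ∧ k ≠ j} → V) → ℂ) →ₗ[ℂ] ((ι → V) → ℂ) :=
    LinearMap.mulLeft ℂ (fun v : ι → V => ω (v i) (v j)) ∘ₗ LinearMap.funLeft ℂ ℂ fun v k => v k
  have hle : Submodule.span ℂ (Set.range (matchingProd (M := M) ω)) ≤
      (Submodule.span ℂ (Set.range (matchingProd (ι := ι) (M := M + 1) ω))).comap T := by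
    rw [Submodule.span_le]
    rintro _ ⟨e, rfl⟩
    obtain ⟨e', he'⟩ := exists_matchingProd_eq_mul ω hij hcard e
    exact Submodule.subset_span ⟨e', funext he'⟩
  exact hle (mem_matchingSpan.1 hf)

variable [DecidableEq ι]

/-- The operator `∑ i, (c + ∑ j, swap i j)` on multilinear forms. -/
noncomputable def swapCasimir (c : ℂ) : Module.End ℂ (MultilinearMap ℂ (fun _ : ι => V) ℂ) :=
  ∑ i, (c • LinearMap.id + ∑ j, (domDomCongrLinearEquiv ℂ ℂ V ℂ (swap i j)).toLinearMap)

theorem swapCasimir_eq (c : ℂ) (f : MultilinearMap ℂ (fun _ : ι => V) ℂ) :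
    swapCasimir c f = ∑ i, (c • f + ∑ j, f.domDomCongr (swap i j)) := by
  simp [swapCasimir, domDomCongrLinearEquiv]

theorem swapCasimir_apply (c : ℂ) (f : MultilinearMap ℂ (fun _ : ι => V) ℂ) (v : ι → V) :
    swapCasimir c f v = ∑ i, (c * f v + ∑ j, f fun k => v (swap i j k)) := by
  simp [swapCasimir_eq, sum_apply]

theorem swapCasimir_mem_matchingSpan {ω : BilinForm ℂ V} {M : ℕ} (c : ℂ)
    {f : MultilinearMap ℂ (fun _ : ι => V) ℂ} (hf : f ∈ matchingSpan ω ι M) :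
    swapCasimir c f ∈ matchingSpan ω ι M := by
  rw [swapCasimir_eq]
  exact Submodule.sum_mem _ fun i _ => Submodule.add_mem _ (Submodule.smul_mem _ _ hf)
    (Submodule.sum_mem _ fun j _ => domDomCongr_mem_matchingSpan hf _)

variable [Fintype κ]

theorem injective_swapCasimir [Nonempty ι] (b : Module.Basis κ ℂ V) :
    Injective (swapCasimir (ι := ι) (V := V) (Fintype.card κ)) := by
  rw [← LinearMap.ker_eq_bot, LinearMap.ker_eq_bot']
  intro f hf
  refine f.eq_zero_of_sum_swap_eq_zero b fun v => ?_
  rw [← swapCasimir_apply, hf, zero_apply]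

theorem mem_matchingSpan_of_swapCasimir_mem [Nonempty ι] (b : Module.Basis κ ℂ V)
    {ω : BilinForm ℂ V} {M : ℕ} {f : MultilinearMap ℂ (fun _ : ι => V) ℂ}
    (hf : swapCasimir (Fintype.card κ) f ∈ matchingSpan ω ι M) : f ∈ matchingSpan ω ι M := by
  have := b.finiteDimensional_of_finite
  let L := (swapCasimir (ι := ι) (V := V) (Fintype.card κ)).restrict
    fun f (hf : f ∈ matchingSpan ω ι M) => swapCasimir_mem_matchingSpan _ hf
  have hL : Injective L := fun x y h =>
    Subtype.ext (injective_swapCasimir b (congrArg Subtype.val h))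
  obtain ⟨g, hg⟩ := LinearMap.injective_iff_surjective.1 hL ⟨_, hf⟩
  rw [← injective_swapCasimir b (congrArg Subtype.val hg)]
  exact g.2

end Matching

theorem IsSpInvariant.mem_matchingSpan {κ V : Type*} [Fintype κ] [DecidableEq κ] [AddCommGroup V]
    [Module ℂ V] {ω : BilinForm ℂ V} (hω : ω.Nondegenerate) (halt : ω.IsAlt)
    (b : Module.Basis κ ℂ V) (M : ℕ) {ι : Type*} [Fintype ι] [DecidableEq ι]
    (hcard : Fintype.card ι = 2 * M) {f : MultilinearMap ℂ (fun _ : ι => V) ℂ}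
    (hf : IsSpInvariant ω f) : f ∈ matchingSpan ω ι M := by
  induction M generalizing ι with
  | zero =>
    have : IsEmpty ι := Fintype.card_eq_zero_iff.1 hcard
    rw [MultilinearMap.mem_matchingSpan]
    have hfv : ⇑f = f isEmptyElim • matchingProd ω (Equiv.equivOfIsEmpty (Fin 0 × Fin 2) ι) := by
      ext v
      simp [matchingProd, Subsingleton.elim v isEmptyElim]
    rw [hfv]
    exact Submodule.smul_mem _ _ (Submodule.subset_span ⟨_, rfl⟩)
  | succ M ih =>
    have : Nonempty ι := Fintype.card_pos_iff.1 (by omega)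
    refine mem_matchingSpan_of_swapCasimir_mem b ?_
    rw [MultilinearMap.mem_matchingSpan]
    have hL : ⇑(swapCasimir (Fintype.card κ) f) = -∑ i, ∑ j, fun v : ι → V =>
        ω (v i) (v j) * contractPair b (ω.dualBasis hω b) f i j fun k => v k := by
      ext v
      simp only [swapCasimir_apply, hf.casimir hω halt b, Finset.sum_neg_distrib, Pi.neg_apply,
        Finset.sum_apply]
    rw [hL]
    refine Submodule.neg_mem _ (Submodule.sum_mem _ fun i _ => Submodule.sum_mem _ fun j _ => ?_)
    rcases eq_or_ne i j with rfl | hij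
    · have h0 : (fun v : ι → V => ω (v i) (v i) *
          contractPair b (ω.dualBasis hω b) f i i fun k => v k) = 0 := by
        ext v
        simp [halt (v i)]
      rw [h0]
      exact Submodule.zero_mem _
    · refine mul_mem_span_matchingProd hij hcard (ih ?_ (hf.contract hω halt b hij))
      have : Fintype.card {k // k ≠ i ∧ k ≠ j} = (({i, j} : Finset ι)ᶜ).card :=
        Fintype.card_of_subtype _ (by simp)
      rw [this, Finset.card_compl, Finset.card_pair hij, hcard]
      omega

end MultilinearMap

section StandardForm

open LinearMap (BilinForm)

/-- The standard symplectic form as a bilinear form. -/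
noncomputable def stdSymplecticBilinForm (n : ℕ) : BilinForm ℂ (Fin (2 * n) → ℂ) :=
  LinearMap.mk₂ ℂ (stdSymplecticForm n)
    (fun u v w => by
      simp only [stdSymplecticForm, Pi.add_apply, ← Finset.sum_add_distrib]
      exact Finset.sum_congr rfl fun i _ => by ring)
    (fun c v w => by
      simp only [stdSymplecticForm, Pi.smul_apply, smul_eq_mul, Finset.mul_sum]
      exact Finset.sum_congr rfl fun i _ => by ring)
    (fun u v w => by
      simp only [stdSymplecticForm, Pi.add_apply, ← Finset.sum_add_distrib]
      exact Finset.sum_congr rfl fun i _ => by ring)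
    (fun c v w => by
      simp only [stdSymplecticForm, Pi.smul_apply, smul_eq_mul, Finset.mul_sum]
      exact Finset.sum_congr rfl fun i _ => by ring)

theorem stdSymplecticBilinForm_apply (n : ℕ) (v w : Fin (2 * n) → ℂ) :
    stdSymplecticBilinForm n v w = stdSymplecticForm n v w :=
  rfl

theorem stdSymplecticBilinForm_isAlt (n : ℕ) : (stdSymplecticBilinForm n).IsAlt := fun v => by
  simp [stdSymplecticBilinForm_apply, stdSymplecticForm, mul_comm]

theorem stdSymplecticBilinForm_nondegenerate (n : ℕ) :
    (stdSymplecticBilinForm n).Nondegenerate := by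
  have halt : LinearMap.IsAlt (stdSymplecticBilinForm n) := stdSymplecticBilinForm_isAlt n
  refine halt.isRefl.nondegenerate_iff_separatingLeft.2 fun v hv => ?_
  simp only [stdSymplecticBilinForm_apply, stdSymplecticForm] at hv
  ext ⟨k, hk⟩
  by_cases hkn : k < n
  · have h := hv (Pi.single ⟨n + k, by omega⟩ 1)
    rw [Finset.sum_eq_single ⟨k, hkn⟩] at h
    · simpa [Pi.single_apply, show n ≠ 0 by omega] using h
    · intro i _ hi
      have h1 : (i : ℕ) ≠ k := fun h => hi (Fin.ext h)
      have h2 : (i : ℕ) ≠ n + k := by omega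
      simp [h1, h2]
    · simp
  · have h := hv (Pi.single ⟨k - n, by omega⟩ 1)
    rw [Finset.sum_eq_single ⟨k - n, by omega⟩] at h
    · simpa [Pi.single_apply, show n + (k - n) = k by omega, show k ≠ k - n by omega] using h
    · intro i _ hi
      have h1 : (i : ℕ) ≠ k - n := fun h => hi (Fin.ext h)
      have h2 : n + (i : ℕ) ≠ k - n := by omega
      simp [h1, h2]
    · simp

/-- The symplectic transvection `v ↦ v + t ω(x, v) x`. -/
noncomputable def symplecticTransvection (n : ℕ) (t : ℂ) (x : Fin (2 * n) → ℂ) :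
    Matrix (Fin (2 * n)) (Fin (2 * n)) ℂ :=
  LinearMap.toMatrix' (LinearMap.id + t • (stdSymplecticBilinForm n x).smulRight x)

theorem symplecticTransvection_mulVec (n : ℕ) (t : ℂ) (x v : Fin (2 * n) → ℂ) :
    (symplecticTransvection n t x).mulVec v = v + t • stdSymplecticBilinForm n x v • x := by
  rw [symplecticTransvection, LinearMap.toMatrix'_mulVec]
  simp

theorem isUnit_symplecticTransvection (n : ℕ) (t : ℂ) (x : Fin (2 * n) → ℂ) :
    IsUnit (symplecticTransvection n t x) := by
  refine IsUnit.of_mul_eq_one (symplecticTransvection n (-t) x) ?_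
  refine Matrix.ext_of_mulVec_single fun i => ?_
  rw [← Matrix.mulVec_mulVec, symplecticTransvection_mulVec, symplecticTransvection_mulVec,
    Matrix.one_mulVec]
  simp [stdSymplecticBilinForm_isAlt n x]

theorem stdSymplecticForm_symplecticTransvection_mulVec (n : ℕ) (t : ℂ)
    (x v w : Fin (2 * n) → ℂ) :
    stdSymplecticForm n ((symplecticTransvection n t x).mulVec v)
      ((symplecticTransvection n t x).mulVec w) = stdSymplecticForm n v w := by
  have halt : LinearMap.IsAlt (stdSymplecticBilinForm n) := stdSymplecticBilinForm_isAlt n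
  have hxv := halt.neg x v
  simp only [symplecticTransvection_mulVec, ← stdSymplecticBilinForm_apply, map_add, map_smul,
    LinearMap.add_apply, LinearMap.smul_apply, halt x, smul_eq_mul, ← hxv]
  ring

end StandardForm

/-- The first fundamental theorem for the symplectic group `Sp(2n, ℂ)` (the purely odd
case of the FFT for the orthosymplectic supergroup): an `Sp(2n,ℂ)`-invariant multilinear
form on `N` copies of `ℂ^{2n}` vanishes if `N` is odd, and if `N = 2M` it is a linear
combination of products of the symplectic form evaluated on the pairs of a perfect
matching of the arguments. -/
theorem fft_symplectic_group (n N : ℕ) (hn : 0 < n) (hN : 0 < N)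
    (f : MultilinearMap ℂ (fun _ : Fin N => (Fin (2 * n) → ℂ)) ℂ)
    (hf : ∀ g : Matrix (Fin (2 * n)) (Fin (2 * n)) ℂ, IsUnit g →
      (∀ v w : Fin (2 * n) → ℂ,
        stdSymplecticForm n (g.mulVec v) (g.mulVec w) = stdSymplecticForm n v w) →
      ∀ v : Fin N → Fin (2 * n) → ℂ, f (fun i => g.mulVec (v i)) = f v) :
    (Odd N → f = 0) ∧
    (∀ (M : ℕ) (hM : N = 2 * M), ∃ c : Equiv.Perm (Fin N) → ℂ,
      ∀ v : Fin N → Fin (2 * n) → ℂ,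
        f v = ∑ σ : Equiv.Perm (Fin N), c σ *
          ∏ i : Fin M,
            stdSymplecticForm n
              (v (σ ⟨2 * i.val, by have := i.isLt; omega⟩))
              (v (σ ⟨2 * i.val + 1, by have := i.isLt; omega⟩))) := by
  refine ⟨fun hodd => ?_, fun M hM => ?_⟩
  · refine MultilinearMap.ext fun v => ?_
    have h := hf (-1) isUnit_one.neg (fun v w => by
      simp [Matrix.neg_mulVec, stdSymplecticForm]) v
    have hneg : f (fun i => (-1 : Matrix _ _ ℂ).mulVec (v i)) = -f v := by
      have := f.map_smul_univ (fun _ => (-1 : ℂ)) v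
      simpa [Matrix.neg_mulVec, hodd.neg_one_pow] using this
    rw [hneg] at h
    simpa using self_eq_neg.1 h.symm
  · have hinv : f.IsSpInvariant (stdSymplecticBilinForm n) := fun x v => by
      have h := f.sum_update_eq_zero_of_forall_add_smul v
        (fun i => stdSymplecticBilinForm n x (v i) • x) fun t => by
          simpa only [symplecticTransvection_mulVec] using
            hf _ (isUnit_symplecticTransvection n t x)
              (stdSymplecticForm_symplecticTransvection_mulVec n t x) v
      simpa using h
    have hmem := hinv.mem_matchingSpan (stdSymplecticBilinForm_nondegenerate n)
      (stdSymplecticBilinForm_isAlt n) (Pi.basisFun ℂ (Fin (2 * n))) M (by simpa using hM)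
    rw [MultilinearMap.mem_matchingSpan, Submodule.mem_span_range_iff_exists_fun] at hmem
    obtain ⟨c, hc⟩ := hmem
    let p : Fin M × Fin 2 ≃ Fin N := finProdFinEquiv.trans (finCongr (by omega))
    have hp0 (i : Fin M) : p (i, 0) = ⟨2 * i.val, by omega⟩ := by
      ext; simp [p]
    have hp1 (i : Fin M) : p (i, 1) = ⟨2 * i.val + 1, by omega⟩ := by
      ext; simp [p, add_comm]
    refine ⟨fun σ => c (p.trans σ), fun v => ?_⟩
    rw [← hc, Finset.sum_apply, ← (Equiv.equivCongr p.symm (Equiv.refl _)).sum_comp]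
    refine Finset.sum_congr rfl fun σ _ => ?_
    simp only [← hp0, ← hp1]
    rfl
end

section
/- Let V be a finite dimensional complex vector space, V^∨ its dual, and N a positive integer. Let f : V^N × (V^∨)^N → ℂ be a map multilinear in all 2N arguments such that f(g·v₁, …, g·v_N, φ₁∘g⁻¹, …, φ_N∘g⁻¹) = f(v₁, …, v_N, φ₁, …, φ_N) for every g ∈ GL(V), all vᵢ ∈ V and all φⱼ ∈ V^∨. Then f lies in the ℂ-linear span of the multilinear maps (v₁, …, v_N, φ₁, …, φ_N) ↦ ∏_{i=1}^{N} φ_{σ(i)}(vᵢ), where σ ranges over the permutations of {1, …, N}. -/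
open MvPolynomial in
/-- Polarization: a multilinear form on endomorphisms whose diagonal vanishes at every invertible
endomorphism has vanishing symmetrization. -/
theorem MultilinearMap.sum_perm_eq_zero_of_forall_linearEquiv
    {V : Type*} [AddCommGroup V] [Module ℂ V] [FiniteDimensional ℂ V] {N : ℕ}
    (D : MultilinearMap ℂ (fun _ : Fin N => V →ₗ[ℂ] V) ℂ)
    (hD : ∀ g : V ≃ₗ[ℂ] V, D (fun _ => (g : V →ₗ[ℂ] V)) = 0)
    (h : Fin N → V →ₗ[ℂ] V) :
    ∑ σ : Equiv.Perm (Fin N), D (fun i => h (σ i)) = 0 := by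
  classical
  let b := Module.finBasis ℂ V
  let k : Option (Fin N) → V →ₗ[ℂ] V := fun o => o.elim LinearMap.id h
  let P : MvPolynomial (Option (Fin N)) ℂ :=
    ∑ s : Fin N → Option (Fin N),
      monomial (∑ j, Finsupp.single (s j) 1) (D fun j => k (s j))
  let Q : MvPolynomial (Option (Fin N)) ℂ :=
    (∑ o, (X o : MvPolynomial (Option (Fin N)) ℂ) •
      (LinearMap.toMatrix b b (k o)).map (C : ℂ →+* MvPolynomial (Option (Fin N)) ℂ)).det
  have hP : ∀ t, eval t P = D fun _ => ∑ o, t o • k o := by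
    intro t
    rw [MultilinearMap.map_sum D (fun (_ : Fin N) o => t o • k o), _root_.map_sum]
    refine Finset.sum_congr rfl fun s _ => ?_
    rw [MultilinearMap.map_smul_univ D (fun j => t (s j)) (fun j => k (s j)), eval_monomial,
      smul_eq_mul, mul_comm,
      ← Finsupp.prod_finsetSum_index (fun _ => pow_zero _) (fun _ _ _ => pow_add _ _ _)]
    simp
  have hQ : ∀ t, eval t Q = LinearMap.det (∑ o, t o • k o) := by
    intro t
    rw [← LinearMap.det_toMatrix b, RingHom.map_det]
    congr 1
    ext i j
    simp [Matrix.sum_apply, Matrix.smul_apply]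
  have hQ0 : Q ≠ 0 := by
    intro hQ0
    have h1 := hQ (Pi.single none 1)
    rw [hQ0, Finset.sum_eq_single none] at h1
    · simp [k] at h1
    · intro o _ ho
      simp [ho]
    · simp
  have hPQ : P * Q = 0 := by
    refine MvPolynomial.funext fun t => ?_
    rw [_root_.map_mul, _root_.map_zero, hP, hQ]
    by_cases hd : LinearMap.det (∑ o, t o • k o) = 0
    · rw [hd, mul_zero]
    · have := hD (LinearMap.equivOfDetNeZero _ hd)
      rw [show ((LinearMap.equivOfDetNeZero _ hd : V ≃ₗ[ℂ] V) : V →ₗ[ℂ] V) = ∑ o, t o • k o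
        from LinearMap.ext fun _ => rfl] at this
      rw [this, zero_mul]
  have hP0 : P = 0 := (mul_eq_zero.mp hPQ).resolve_right hQ0
  have hc := congrArg (coeff (∑ i : Fin N, Finsupp.single (some i) 1)) hP0
  rw [coeff_zero, coeff_sum] at hc
  rw [← hc]
  refine Finset.sum_of_injOn (fun σ j => some (σ j)) ?_ (by simp) ?_ ?_
  · intro σ _ τ _ hst
    ext i
    simpa using congrArg (Fin.val) (Option.some_injective _ (congrFun hst i))
  · intro s _ hs
    rw [coeff_monomial, if_neg]
    intro heq
    apply hs
    have hex : ∀ i : Fin N, ∃ j, s j = some i := by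
      intro i
      by_contra! hne
      have := DFunLike.congr_fun heq (some i)
      simp [Finsupp.finsetSum_apply, Finsupp.single_apply, hne] at this
    choose r hr using hex
    have hinj : Function.Injective r := fun i j hij => by
      have := hr i
      rw [hij, hr j] at this
      exact (Option.some_injective _ this).symm
    let e := Equiv.ofBijective r (Finite.injective_iff_bijective.mp hinj)
    refine ⟨e.symm, by simp, funext fun j => ?_⟩
    exact (hr (e.symm j)).symm.trans (congrArg s (e.apply_symm_apply j))
  · intro σ _
    rw [coeff_monomial, if_pos]
    · rfl
    · exact Equiv.sum_comp σ fun i => Finsupp.single (some i) 1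

/-- Every vector agrees with a vector in the range of `Aᴴ` up to an element of the kernel
of `A`. -/
theorem Matrix.exists_mulVec_conjTranspose_mulVec_eq
    {m n : Type*} [Fintype m] [Fintype n] (A : Matrix m n ℂ) (x : n → ℂ) :
    ∃ y : m → ℂ, A.mulVec (A.conjTranspose.mulVec y) = A.mulVec x := by
  open scoped ComplexOrder in
  have hle : LinearMap.range (A * A.conjTranspose).mulVecLin ≤ LinearMap.range A.mulVecLin := by
    rw [Matrix.mulVecLin_mul]
    exact LinearMap.range_comp_le_range _ _
  have heq := Submodule.eq_of_le_of_finrank_eq hle (Matrix.rank_self_mul_conjTranspose A)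
  have hx : A.mulVecLin x ∈ LinearMap.range (A * A.conjTranspose).mulVecLin := by
    rw [heq]
    exact LinearMap.mem_range_self _ x
  obtain ⟨y, hy⟩ := hx
  exact ⟨y, by simpa using hy⟩

/-- Evaluation at `φ`, as a linear map on multilinear maps. -/
def MultilinearMap.evalLinear {R ι M P : Type*} [CommSemiring R] [AddCommMonoid M]
    [AddCommMonoid P] [Module R M] [Module R P] (φ : ι → M) :
    MultilinearMap R (fun _ : ι => M) P →ₗ[R] P where
  toFun f := f φ
  map_add' _ _ := rfl
  map_smul' _ _ := rfl

section Invariant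

variable {V : Type*} [AddCommGroup V] [Module ℂ V] {N : ℕ}
  (f : MultilinearMap ℂ (fun _ : Fin N => V)
    (MultilinearMap ℂ (fun _ : Fin N => Module.Dual ℂ V) ℂ))

/-- An invariant form intertwines the symmetrized actions of arbitrary endomorphisms on vectors
and on covectors. -/
theorem MultilinearMap.sum_perm_endomorphism_eq_of_invariant [FiniteDimensional ℂ V]
    (hf : ∀ g : V ≃ₗ[ℂ] V, ∀ (v : Fin N → V) (φ : Fin N → Module.Dual ℂ V),
      f (fun i => g (v i)) (fun j => (φ j).comp (g.symm : V →ₗ[ℂ] V)) = f v φ)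
    (h : Fin N → V →ₗ[ℂ] V) (v : Fin N → V) (φ : Fin N → Module.Dual ℂ V) :
    ∑ σ : Equiv.Perm (Fin N), f (fun i => h (σ i) (v i)) φ =
      ∑ σ : Equiv.Perm (Fin N), f v (fun i => (φ i).comp (h (σ i))) := by
  let D : MultilinearMap ℂ (fun _ : Fin N => V →ₗ[ℂ] V) ℂ :=
    (MultilinearMap.evalLinear φ).compMultilinearMap
        (f.compLinearMap fun i => LinearMap.applyₗ (v i)) -
      (f v).compLinearMap fun i => LinearMap.compRight ℂ (φ i)
  have hD : ∀ k, D k = f (fun i => k i (v i)) φ - f v (fun i => (φ i).comp (k i)) :=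
    fun _ => rfl
  have key := D.sum_perm_eq_zero_of_forall_linearEquiv (fun g => ?_) h
  · simp only [hD, Finset.sum_sub_distrib] at key
    exact sub_eq_zero.mp key
  · rw [hD, sub_eq_zero, ← hf g v]
    congr 1
    ext i x
    simp

/-- The identity for invariant forms obtained by specializing endomorphisms to rank one. -/
theorem MultilinearMap.sum_perm_pairing_eq_of_invariant [FiniteDimensional ℂ V]
    (hf : ∀ g : V ≃ₗ[ℂ] V, ∀ (v : Fin N → V) (φ : Fin N → Module.Dual ℂ V),
      f (fun i => g (v i)) (fun j => (φ j).comp (g.symm : V →ₗ[ℂ] V)) = f v φ)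
    (v w : Fin N → V) (φ ψ : Fin N → Module.Dual ℂ V) :
    ∑ σ : Equiv.Perm (Fin N), (∏ i, ψ (σ i) (v i)) * f (fun i => w (σ i)) φ =
      ∑ σ : Equiv.Perm (Fin N), (∏ i, φ i (w (σ i))) * f v (fun i => ψ (σ i)) := by
  have key := f.sum_perm_endomorphism_eq_of_invariant hf
    (fun i => (ψ i).smulRight (w i)) v φ
  have hcomp : ∀ i j, (φ i).comp ((ψ j).smulRight (w j)) = φ i (w j) • ψ j := by
    intro i j
    ext x
    simp [mul_comm]
  simp only [LinearMap.smulRight_apply, hcomp] at key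
  simpa only [MultilinearMap.map_smul_univ, smul_apply, smul_eq_mul] using key

/-- A linear combination of place permutations that kills all basis tensors kills every
multilinear map. -/
theorem MultilinearMap.sum_perm_eq_zero_of_pairing {P ι : Type*} [AddCommGroup P] [Module ℂ P]
    [Fintype ι] (b : Module.Basis ι ℂ V) (F : MultilinearMap ℂ (fun _ : Fin N => V) P)
    (r : Equiv.Perm (Fin N) → ℂ)
    (hr : ∀ a c : Fin N → ι,
      ∑ σ : Equiv.Perm (Fin N), (∏ i, b.coord (c (σ i)) (b (a i))) * r σ = 0)
    (w : Fin N → V) :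
    ∑ σ : Equiv.Perm (Fin N), r σ • F (fun i => w (σ i)) = 0 := by
  classical
  have key : ∑ σ : Equiv.Perm (Fin N), r σ • F.domDomCongr σ = 0 := by
    refine Module.Basis.ext_multilinear (fun _ => b) fun c => ?_
    have hA : ∀ (a : Fin N → ι) (σ : Equiv.Perm (Fin N)),
        ∏ i, b.coord (c (σ i)) (b (a i)) = if a = fun i => c (σ i) then 1 else 0 := by
      intro a σ
      simp [Finsupp.single_apply, Finset.prod_ite_zero, funext_iff]
    have hsum : ∀ σ : Equiv.Perm (Fin N), F (fun i => b (c (σ i))) =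
        ∑ a : Fin N → ι, (∏ i, b.coord (c (σ i)) (b (a i))) • F fun i => b (a i) := by
      intro σ
      simp only [hA, ite_smul, one_smul, zero_smul, Finset.sum_ite_eq', Finset.mem_univ, if_true]
    simp only [sum_apply, smul_apply,
      MultilinearMap.domDomCongr_apply, zero_apply, hsum, Finset.smul_sum]
    rw [Finset.sum_comm]
    refine Finset.sum_eq_zero fun a _ => ?_
    simp only [smul_smul, ← Finset.sum_smul]
    simp only [mul_comm (r _), hr, zero_smul]
  simpa [sum_apply] using congrArg (fun m => m w) key

end Invariant


/-- The first fundamental theorem for `GL(V)`: a multilinear form on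
`V^N × (V^∨)^N` (formalized as a multilinear map in the `N` vector arguments with
values in multilinear maps in the `N` covector arguments) which is invariant under
`g : (v, φ) ↦ (g v, φ ∘ g⁻¹)` for all `g ∈ GL(V)` is a linear combination of the
complete pairings `(v, φ) ↦ ∏ᵢ φ_{σ(i)}(vᵢ)`, `σ` a permutation of `{1, …, N}`. -/
theorem fft_general_linear_group
    (V : Type*) [AddCommGroup V] [Module ℂ V] [FiniteDimensional ℂ V]
    (N : ℕ) (hN : 0 < N)
    (f : MultilinearMap ℂ (fun _ : Fin N => V)
      (MultilinearMap ℂ (fun _ : Fin N => Module.Dual ℂ V) ℂ))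
    (hf : ∀ g : V ≃ₗ[ℂ] V, ∀ (v : Fin N → V) (φ : Fin N → Module.Dual ℂ V),
      f (fun i => g (v i)) (fun j => (φ j).comp (g.symm : V →ₗ[ℂ] V)) = f v φ) :
    ∃ c : Equiv.Perm (Fin N) → ℂ,
      ∀ (v : Fin N → V) (φ : Fin N → Module.Dual ℂ V),
        f v φ = ∑ σ : Equiv.Perm (Fin N), c σ * ∏ i : Fin N, φ (σ i) (v i) := by
  classical
  let b := Module.finBasis ℂ V
  let A : Matrix ((Fin N → Fin (Module.finrank ℂ V)) × (Fin N → Fin (Module.finrank ℂ V)))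
      (Equiv.Perm (Fin N)) ℂ :=
    Matrix.of fun p σ => ∏ i, b.coord (p.2 (σ i)) (b (p.1 i))
  have hreal : ∀ p σ, star (A p σ) = A p σ := by
    intro p σ
    simp only [A, Matrix.of_apply, star_prod]
    refine Finset.prod_congr rfl fun i _ => ?_
    simp [Finsupp.single_apply, apply_ite]
  obtain ⟨y, hy⟩ := A.exists_mulVec_conjTranspose_mulVec_eq (Pi.single 1 1)
  set x := A.conjTranspose.mulVec y with hx
  have hxσ : ∀ σ, x σ = ∑ p, y p * A p σ := by
    intro σ
    simp only [hx, Matrix.mulVec, dotProduct, Matrix.conjTranspose_apply, hreal]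
    exact Finset.sum_congr rfl fun p _ => mul_comm _ _
  refine ⟨fun σ => ∑ p, y p * f (fun i => b (p.1 i)) (fun i => b.coord (p.2 (σ⁻¹ i))),
    fun v φ => ?_⟩
  have hker := f.sum_perm_eq_zero_of_pairing b (Pi.single 1 1 - x) (fun a c => by
    have := congrFun (sub_eq_zero.mpr hy.symm) (a, c)
    rw [← Matrix.mulVec_sub] at this
    exact this) v
  have hfv : f v φ = ∑ σ, x σ * f (fun i => v (σ i)) φ := by
    have := congrArg (fun m => m φ) hker
    simp only [Pi.sub_apply, sub_smul, Finset.sum_sub_distrib, sub_apply,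
      sum_apply, smul_apply, smul_eq_mul,
      zero_apply, sub_eq_zero] at this
    rw [← this]
    simp [Pi.single_apply]
  have hpair : ∀ p : (Fin N → Fin (Module.finrank ℂ V)) × (Fin N → Fin (Module.finrank ℂ V)),
      ∑ σ, A p σ * f (fun i => v (σ i)) φ =
        ∑ σ : Equiv.Perm (Fin N), (∏ i, φ i (v (σ i))) *
          f (fun i => b (p.1 i)) (fun i => b.coord (p.2 (σ i))) := fun p =>
    f.sum_perm_pairing_eq_of_invariant hf (fun i => b (p.1 i)) v φ (fun i => b.coord (p.2 i))
  calc f v φ = ∑ p, y p * ∑ σ, A p σ * f (fun i => v (σ i)) φ := by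
        simp only [hfv, hxσ, Finset.sum_mul, Finset.mul_sum]
        rw [Finset.sum_comm]
        simp only [mul_assoc]
    _ = ∑ σ : Equiv.Perm (Fin N), (∑ p, y p * f (fun i => b (p.1 i))
          (fun i => b.coord (p.2 (σ i)))) * ∏ i, φ i (v (σ i)) := by
        simp only [hpair, Finset.sum_mul, Finset.mul_sum]
        rw [Finset.sum_comm]
        exact Finset.sum_congr rfl fun σ _ => Finset.sum_congr rfl fun p _ => by ring
    _ = _ := by
        rw [← Equiv.sum_comp (Equiv.inv (Equiv.Perm (Fin N)))]
        refine Finset.sum_congr rfl fun σ _ => ?_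
        simp only [Equiv.inv_apply]
        rw [← Equiv.prod_comp σ fun i => φ i (v (σ⁻¹ i))]
        simp
end

section
/- Let V be a finite dimensional complex vector space and N a positive integer. Every ℂ-linear endomorphism T of the N-fold tensor power V^{⊗N} satisfying T ∘ (g ⊗ g ⊗ ⋯ ⊗ g) = (g ⊗ g ⊗ ⋯ ⊗ g) ∘ T for every g ∈ GL(V) lies in the ℂ-linear span of the permutation operators P_σ : V^{⊗N} → V^{⊗N}, σ a permutation of {1, …, N}, where P_σ(v₁ ⊗ ⋯ ⊗ v_N) = v_{σ⁻¹(1)} ⊗ ⋯ ⊗ v_{σ⁻¹(N)}. -/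
open scoped TensorProduct

/-- Polarization: the symmetrization of a multilinear map lies in any submodule containing its
values on the diagonal. -/
theorem MultilinearMap.sum_perm_mem_of_diagonal_mem {R E F ι : Type*} [CommRing R]
    [AddCommGroup E] [Module R E] [AddCommGroup F] [Module R F] [Fintype ι] [DecidableEq ι]
    (f : MultilinearMap R (fun _ : ι => E) F) (W : Submodule R F)
    (hW : ∀ a : E, f (fun _ => a) ∈ W) (m : ι → E) :
    ∑ σ : Equiv.Perm ι, f (m ∘ σ) ∈ W := by
  have key : ∑ σ : Equiv.Perm ι, f (m ∘ σ) =
      ∑ U : Finset ι, (-1 : ℤ) ^ U.card • f (fun _ => ∑ j ∈ Uᶜ, m j) := by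
    simp_rw [f.map_sum_finset (fun _ => m), Finset.smul_sum]
    rw [Finset.sum_comm' (t' := Finset.univ)
      (s' := fun r : ι → ι => (Finset.univ.image r)ᶜ.powerset)]
    · simp_rw [← Finset.sum_smul, Finset.sum_powerset_neg_one_pow_card, ite_smul, one_smul,
        zero_smul]
      rw [← Finset.sum_filter]
      refine Finset.sum_bij (fun σ _ => ⇑σ) ?_ ?_ ?_ ?_
      · intro σ _
        simp [Finset.image_univ_equiv]
      · intro σ _ τ _ h
        exact DFunLike.coe_injective h
      · intro r hr
        have hs : Function.Surjective r := by
          simpa [Finset.eq_univ_iff_forall, Function.Surjective] using hr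
        exact ⟨Equiv.ofBijective r (Finite.surjective_iff_bijective.mp hs), Finset.mem_univ _, rfl⟩
      · intro σ _
        rfl
    · intro U r
      simp only [Finset.mem_univ, true_and, Fintype.mem_piFinset, Finset.mem_compl, and_true,
        Finset.mem_powerset, Finset.subset_iff, Finset.mem_image, not_exists]
      exact ⟨fun h i hi j hj => h j (hj ▸ hi), fun h i hi => h hi i rfl⟩
  rw [key]
  exact W.sum_mem fun U _ => zsmul_mem (hW _) _

/-- A submodule containing the values of a multilinear map on the diagonal at all invertible
endomorphisms contains its values on the whole diagonal. -/
theorem MultilinearMap.diagonal_mem_of_forall_linearEquiv {K V F ι : Type*} [Field K] [Infinite K]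
    [AddCommGroup V] [Module K V] [FiniteDimensional K V] [AddCommGroup F] [Module K F] [Fintype ι]
    (f : MultilinearMap K (fun _ : ι => Module.End K V) F) (W : Submodule K F)
    (hW : ∀ g : V ≃ₗ[K] V, f (fun _ => (g : V →ₗ[K] V)) ∈ W) (a : Module.End K V) :
    f (fun _ => a) ∈ W := by
  classical
  by_contra hmem
  obtain ⟨φ, hφ, hφW⟩ := Submodule.exists_le_ker_of_notMem hmem
  let p : Polynomial K := ∑ s : Finset ι,
    Polynomial.C (φ (f (s.piecewise (fun _ => a) (fun _ => 1)))) * Polynomial.X ^ sᶜ.card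
  have hp (t : K) : p.eval t = φ (f (fun _ => a + t • 1)) := by
    have hadd := f.map_add_univ (fun _ => a) (fun _ => t • 1)
    simp only [Pi.add_def] at hadd
    rw [hadd, _root_.map_sum, Polynomial.eval_finsetSum]
    refine Finset.sum_congr rfl fun s _ => ?_
    have hs := f.map_piecewise_smul (fun _ => t) (s.piecewise (fun _ => a) (fun _ => 1)) sᶜ
    have hpw : sᶜ.piecewise (fun i => t • s.piecewise (fun _ => a) (fun _ => 1) i)
        (s.piecewise (fun _ => a) (fun _ => 1)) =
        s.piecewise (fun _ => a) (fun _ => t • (1 : Module.End K V)) := by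
      ext1 i
      by_cases hi : i ∈ s <;> simp [hi]
    rw [hpw] at hs
    rw [hs]
    rw [map_smul, Finset.prod_const, Polynomial.eval_mul, Polynomial.eval_C, Polynomial.eval_pow,
      Polynomial.eval_X, smul_eq_mul, mul_comm]
  have hzero : p = 0 := by
    refine Polynomial.eq_zero_of_infinite_isRoot p
      ((Module.End.finite_spectrum (-a)).infinite_compl.mono ?_)
    intro t ht
    obtain ⟨u, hu⟩ := spectrum.notMem_iff.mp ht
    have hmem := hφW (hW (LinearMap.GeneralLinearGroup.toLinearEquiv u))
    have hu' : ((LinearMap.GeneralLinearGroup.toLinearEquiv u : V ≃ₗ[K] V) : V →ₗ[K] V) =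
        a + t • (1 : Module.End K V) := by
      rw [sub_neg_eq_add, add_comm, Algebra.algebraMap_eq_smul_one] at hu
      exact hu
    rw [hu'] at hmem
    exact (hp t).trans hmem
  have h0 := hp 0
  simp [hzero] at h0
  exact hφ h0.symm

/-- The endomorphisms `f₁ ⊗ ⋯ ⊗ fₙ` span the endomorphisms of the tensor power. -/
theorem PiTensorProduct.span_range_map_eq_top {K V ι : Type*} [Field K]
    [AddCommGroup V] [Module K V] [FiniteDimensional K V] [Fintype ι] :
    Submodule.span K (Set.range fun f : ι → Module.End K V => PiTensorProduct.map f) = ⊤ := by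
  classical
  refine eq_top_iff.mpr fun S _ => ?_
  let b := Module.finBasis K V
  let B := Basis.piTensorProduct (fun _ : ι => b)
  have key : S = ∑ q, ∑ p, B.repr (S (B q)) p •
      PiTensorProduct.map (fun i => (b.coord (q i)).smulRight (b (p i))) := by
    refine B.ext fun r => ?_
    have hmap (q p : ι → Fin (Module.finrank K V)) :
        PiTensorProduct.map (fun i => (b.coord (q i)).smulRight (b (p i))) (B r) =
          if q = r then B p else 0 := by
      have hsm := (PiTensorProduct.tprod K).map_smul_univ
        (fun i => b.repr (b (r i)) (q i)) (fun i => b (p i))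
      simp only [B, Basis.piTensorProduct_apply, PiTensorProduct.map_tprod,
        LinearMap.smulRight_apply, Module.Basis.coord_apply, hsm]
      simp [Finsupp.single_apply, Fintype.prod_ite_zero, funext_iff, eq_comm]
    simp only [LinearMap.sum_apply, LinearMap.smul_apply, hmap]
    simp [B.sum_repr]
  rw [key]
  exact Submodule.sum_mem _ fun q _ => Submodule.sum_mem _ fun p _ =>
    Submodule.smul_mem _ _ (Submodule.subset_span ⟨_, rfl⟩)

/-- The double commutant theorem for a finite-dimensional representation of a finite group. -/
theorem Representation.exists_asAlgebraHom_eq_of_forall_commute {K G M : Type*} [Field K]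
    [Group G] [Finite G] [NeZero (Nat.card G : K)] [AddCommGroup M] [Module K M]
    [FiniteDimensional K M] (ρ : Representation K G M) (T : Module.End K M)
    (hT : ∀ S : Module.End K M, (∀ g, Commute (ρ g) S) → Commute T S) :
    ∃ r, ρ.asAlgebraHom r = T := by
  obtain ⟨s, hs⟩ := Module.Finite.fg_top (R := K) (M := M)
  let f : Module.End (Module.End (MonoidAlgebra K G) ρ.asModule) ρ.asModule :=
    { toFun := fun x => ρ.asModuleEquiv.symm (T (ρ.asModuleEquiv x))
      map_add' := by simp
      map_smul' := by
        intro S x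
        let S' : Module.End K M :=
          ρ.asModuleEquiv.toLinearMap ∘ₗ S.restrictScalars K ∘ₗ ρ.asModuleEquiv.symm.toLinearMap
        have hS' : ∀ g, Commute (ρ g) S' := by
          intro g
          ext y
          have := S.map_smul (MonoidAlgebra.of K G g) (ρ.asModuleEquiv.symm y)
          rw [← ρ.asModuleEquiv_symm_map_rho] at this
          have := congrArg ρ.asModuleEquiv this
          rw [ρ.asModuleEquiv_map_smul, ρ.asAlgebraHom_of] at this
          exact this.symm
        have := LinearMap.congr_fun (hT S' hS') (ρ.asModuleEquiv x)
        simp [S'] at this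
        simp [this] }
  obtain ⟨r, hr⟩ := jacobson_density f (s.map ρ.asModuleEquiv.symm.toEquiv.toEmbedding)
  refine ⟨r, LinearMap.ext_on hs fun x hx => ?_⟩
  have hx' := congrArg ρ.asModuleEquiv
    (hr (ρ.asModuleEquiv.symm x) (Finset.mem_map_of_mem _ (Finset.mem_coe.mp hx)))
  rw [ρ.asModuleEquiv_map_smul] at hx'
  simpa [f] using hx'.symm

/-- The action of the permutations of `ι` on `V^{⊗ι}` by permuting the factors. -/
noncomputable def PiTensorProduct.permRepresentation (K V ι : Type*) [CommSemiring K]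
    [AddCommMonoid V] [Module K V] : Representation K (Equiv.Perm ι) (⨂[K] _ : ι, V) where
  toFun σ := (PiTensorProduct.reindex K (fun _ => V) σ).toLinearMap
  map_one' := by
    ext v
    exact reindex_tprod 1 v
  map_mul' σ τ := by
    ext v
    have h (π : Equiv.Perm ι) (w : ι → V) :
        (reindex K (fun _ => V) π).toLinearMap (tprod K w) = tprod K fun i => w (π.symm i) :=
      reindex_tprod π w
    simp only [LinearMap.compMultilinearMap_apply, Module.End.mul_apply, h]
    rfl

theorem PiTensorProduct.permRepresentation_tprod {K V ι : Type*} [CommSemiring K]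
    [AddCommMonoid V] [Module K V] (σ : Equiv.Perm ι) (v : ι → V) :
    permRepresentation K V ι σ (tprod K v) = tprod K fun i => v (σ⁻¹ i) :=
  PiTensorProduct.reindex_tprod σ v

/-- An endomorphism of `V^{⊗ι}` commuting with `g ⊗ ⋯ ⊗ g` for all `g ∈ GL(V)` commutes with every
endomorphism that commutes with the permutations of the factors. -/
theorem PiTensorProduct.commute_of_commute_permRepresentation {K V ι : Type*} [Field K] [CharZero K]
    [AddCommGroup V] [Module K V] [FiniteDimensional K V] [Fintype ι]
    {T : Module.End K (⨂[K] _ : ι, V)}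
    (hT : ∀ g : V ≃ₗ[K] V, Commute T (map fun _ => (g : V →ₗ[K] V)))
    {S : Module.End K (⨂[K] _ : ι, V)} (hS : ∀ σ, Commute (permRepresentation K V ι σ) S) :
    Commute T S := by
  classical
  let ρ := permRepresentation K V ι
  let W : Submodule K (Module.End K (⨂[K] _ : ι, V)) :=
    LinearMap.ker (LinearMap.mulLeft K T - LinearMap.mulRight K T)
  have hW (X : Module.End K (⨂[K] _ : ι, V)) : X ∈ W ↔ Commute T X := by
    simp [W, sub_eq_zero, Commute, SemiconjBy]
  let sym : Module.End K (⨂[K] _ : ι, V) →ₗ[K] Module.End K (⨂[K] _ : ι, V) :=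
    ∑ σ, LinearMap.mulLeft K (ρ σ⁻¹) ∘ₗ LinearMap.mulRight K (ρ σ)
  have hconj (f : ι → Module.End K V) (σ : Equiv.Perm ι) :
      ρ σ⁻¹ * (map f * ρ σ) = map (f ∘ σ) := by
    ext v
    simp only [ρ, LinearMap.compMultilinearMap_apply, Module.End.mul_apply,
      permRepresentation_tprod, map_tprod, Function.comp_apply, inv_inv]
    exact congrArg (tprod K) (funext fun i =>
      congrArg (fun j => f (σ i) (v j)) (σ.symm_apply_apply i))
  have hsym : ⊤ ≤ W.comap sym := by
    rw [← span_range_map_eq_top, Submodule.span_le]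
    rintro _ ⟨f, rfl⟩
    have := (mapMultilinear K (fun _ : ι => V) (fun _ => V)).sum_perm_mem_of_diagonal_mem W
      (MultilinearMap.diagonal_mem_of_forall_linearEquiv _ W fun g => (hW _).mpr (hT g)) f
    simpa [sym, hconj] using this
  have hsymS : sym S = (Fintype.card (Equiv.Perm ι) : K) • S := by
    have (σ : Equiv.Perm ι) : ρ σ⁻¹ * (S * ρ σ) = S := by
      rw [← (hS σ).eq, ← mul_assoc, ← map_mul, inv_mul_cancel, map_one, one_mul]
    simp [sym, this, Nat.cast_smul_eq_nsmul]
  have hmem : sym S ∈ W := hsym trivial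
  rw [hsymS, Submodule.smul_mem_iff _ (Nat.cast_ne_zero.mpr Fintype.card_ne_zero)] at hmem
  exact (hW S).mp hmem

/-- Schur–Weyl duality between `GL(V)` and the symmetric group `S_N`: every linear
endomorphism `T` of `V^{⊗N}` commuting with all operators `g ⊗ ⋯ ⊗ g`, `g ∈ GL(V)`,
lies in the linear span of the permutation operators
`P_σ : v₁ ⊗ ⋯ ⊗ v_N ↦ v_{σ⁻¹(1)} ⊗ ⋯ ⊗ v_{σ⁻¹(N)}`. -/
theorem schur_weyl_duality
    (V : Type*) [AddCommGroup V] [Module ℂ V] [FiniteDimensional ℂ V]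
    (N : ℕ) (hN : 0 < N)
    (T : (⨂[ℂ] _ : Fin N, V) →ₗ[ℂ] (⨂[ℂ] _ : Fin N, V))
    (hT : ∀ g : V ≃ₗ[ℂ] V,
      T ∘ₗ PiTensorProduct.map (fun _ : Fin N => (g : V →ₗ[ℂ] V)) =
        PiTensorProduct.map (fun _ : Fin N => (g : V →ₗ[ℂ] V)) ∘ₗ T) :
    ∃ c : Equiv.Perm (Fin N) → ℂ,
      ∀ v : Fin N → V,
        T (PiTensorProduct.tprod ℂ v) =
          ∑ σ : Equiv.Perm (Fin N),
            c σ • PiTensorProduct.tprod ℂ (fun i => v (σ⁻¹ i)) := by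
  let ρ := PiTensorProduct.permRepresentation ℂ V (Fin N)
  obtain ⟨r, hr⟩ := ρ.exists_asAlgebraHom_eq_of_forall_commute T fun S hS =>
    PiTensorProduct.commute_of_commute_permRepresentation hT hS
  refine ⟨fun σ => r.coeff σ, fun v => ?_⟩
  rw [← hr, Representation.asAlgebraHom_def, MonoidAlgebra.lift_apply,
    Finsupp.sum_fintype _ _ (by simp), LinearMap.sum_apply]
  refine Finset.sum_congr rfl fun σ _ => ?_
  rw [LinearMap.smul_apply, PiTensorProduct.permRepresentation_tprod]
end

section
/- Let m, N be positive integers with N even, and let f : (ℂ^m)^N → ℂ be a multilinear map invariant under the orthogonal group O(m,ℂ) = {g ∈ GL_m(ℂ) : gᵀg = 1}, i.e. f(g·v₁, …, g·v_N) = f(v₁, …, v_N) for all g ∈ O(m,ℂ). Then there exists a polynomial P with complex coefficients in the N·m vector variables (v_i)_j and the m² matrix variables A_{jk}, defining a function F(v₁, …, v_N, A) on (ℂ^m)^N × M_m(ℂ), such that: (i) f(v₁, …, v_N) = F(v₁, …, v_N, 1) where 1 is the identity matrix, and (ii) F(g·v₁, …, g·v_N, A) = F(v₁, …, v_N, gᵀAg)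 for all g ∈ GL_m(ℂ), all A ∈ M_m(ℂ) and all v₁, …, v_N ∈ ℂ^m. -/
open scoped Matrix

/-- The point of affine space with coordinates `t` and the entries of the matrix `A`. -/
def matrixPoint {σ ι κ : Type*} (t : σ → ℂ) (A : Matrix ι κ ℂ) : σ ⊕ (ι × κ) → ℂ :=
  Sum.elim t fun q => A q.1 q.2

@[simp]
lemma matrixPoint_inl {σ ι κ : Type*} (t : σ → ℂ) (A : Matrix ι κ ℂ) (x : σ) :
    matrixPoint t A (Sum.inl x) = t x := rfl

@[simp]
lemma matrixPoint_inr {σ ι κ : Type*} (t : σ → ℂ) (A : Matrix ι κ ℂ) (q : ι × κ) :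
    matrixPoint t A (Sum.inr q) = A q.1 q.2 := rfl

lemma exists_matrixPoint_eq {σ ι κ : Type*} (w : σ ⊕ (ι × κ) → ℂ) :
    ∃ (t : σ → ℂ) (A : Matrix ι κ ℂ), w = matrixPoint t A :=
  ⟨fun x => w (Sum.inl x), fun i j => w (Sum.inr (i, j)), by ext (x | q) <;> rfl⟩

/-- Over `ℂ`, every symmetric matrix is a Gram matrix for the standard bilinear form. -/
lemma Matrix.IsSymm.exists_eq_transpose_mul_self {m : ℕ} {A : Matrix (Fin m) (Fin m) ℂ}
    (hA : A.IsSymm) : ∃ g : Matrix (Fin m) (Fin m) ℂ, gᵀ * g = A := by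
  have : Invertible (2 : ℂ) := invertibleOfNonzero two_ne_zero
  have hB := Matrix.isSymm_toBilin'_iff_isSymm.2 hA
  obtain ⟨v₀, hv₀⟩ := LinearMap.BilinForm.exists_orthogonal_basis
    (B := A.toBilin') ⟨fun x y => hB.eq x y⟩
  have hfin : Module.finrank ℂ (Fin m → ℂ) = m := by simp
  let v := v₀.reindex (finCongr hfin)
  have hv : ∀ i j, i ≠ j → A.toBilin' (v i) (v j) = 0 := by
    intro i j hij
    simp only [v, Module.Basis.reindex_apply]
    exact hv₀ (by simpa using hij)
  choose r hr using fun i => IsAlgClosed.exists_eq_mul_self (A.toBilin' (v i) (v i))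
  refine ⟨Matrix.of fun i j => r i * v.repr (Pi.single j 1) i, ?_⟩
  ext j k
  have h : A.toBilin' (Pi.single j 1) (Pi.single k 1) = A j k :=
    Matrix.toBilin'_single A j k
  rw [← h, ← LinearMap.sum_repr_mul_repr_mul v v, Matrix.mul_apply,
    Finsupp.sum_fintype _ _ (by simp)]
  refine Finset.sum_congr rfl fun i _ => ?_
  rw [Finsupp.sum_fintype _ _ (by simp), Finset.sum_eq_single i]
  · simp only [Matrix.transpose_apply, Matrix.of_apply, hr, smul_eq_mul]
    ring
  · intro l _ hl
    simp [hv i l hl.symm]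
  · simp

/-- Polynomials which agree off a hypersurface are equal. -/
lemma MvPolynomial.eq_of_eval_eq_of_eval_ne_zero {τ : Type*} {p q r : MvPolynomial τ ℂ}
    (hr : r ≠ 0) (h : ∀ x, eval x r ≠ 0 → eval x p = eval x q) : p = q := by
  have : r * (p - q) = 0 := by
    refine MvPolynomial.funext fun x => ?_
    by_cases hx : eval x r = 0
    · simp [hx]
    · simp [h x hx]
  exact sub_eq_zero.1 ((mul_eq_zero.1 this).resolve_left hr)

lemma MvPolynomial.eval_bind₁ {τ ρ : Type*} (x : τ → ℂ) (f : ρ → MvPolynomial τ ℂ)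
    (Q : MvPolynomial ρ ℂ) : eval x (bind₁ f Q) = eval (fun i => eval x (f i)) Q := by
  rw [eval, eval₂Hom_bind₁]; rfl

/-- A polynomial vanishing on a coordinate hyperplane is divisible by that coordinate. -/
lemma MvPolynomial.X_dvd_of_eval_eq_zero {τ : Type*} {z : τ} {Q : MvPolynomial τ ℂ}
    (h : ∀ x : τ → ℂ, x z = 0 → eval x Q = 0) : X z ∣ Q := by
  classical
  have h0 : bind₁ (fun i => if i = z then 0 else X i) Q = 0 := by
    refine MvPolynomial.funext fun x => ?_
    rw [eval_bind₁, map_zero]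
    exact h _ (by simp)
  rw [← Ideal.mem_span_singleton, ← Ideal.Quotient.eq_zero_iff_mem]
  have hom : (Ideal.Quotient.mkₐ ℂ (Ideal.span {(X z : MvPolynomial τ ℂ)})).comp
      (bind₁ fun i => if i = z then 0 else X i) = Ideal.Quotient.mkₐ ℂ _ := by
    ext i
    by_cases hi : i = z
    · subst hi
      simp only [AlgHom.comp_apply, bind₁_X_right, if_true, map_zero]
      exact (Ideal.Quotient.eq_zero_iff_mem.2 (Ideal.mem_span_singleton_self _)).symm
    · simp [hi]
  have := DFunLike.congr_fun hom Q
  rw [AlgHom.comp_apply, h0, map_zero] at this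
  exact this.symm

/-- If every coordinate of `S w s` is of the form `(U w + s * V w) / s ^ (2 * k)` on the locus
`s ^ 2 = w z ≠ 0`, then so is every polynomial in these coordinates. -/
lemma MvPolynomial.exists_eval_mul_pow_eq_add {τ ρ : Type*} (z : τ)
    (S : (τ → ℂ) → ℂ → ρ → ℂ)
    (hS : ∀ i, ∃ (k : ℕ) (U V : MvPolynomial τ ℂ), ∀ w s, s ^ 2 = w z → s ≠ 0 →
      S w s i * w z ^ k = eval w U + s * eval w V)
    (Q : MvPolynomial ρ ℂ) :
    ∃ (k : ℕ) (U V : MvPolynomial τ ℂ), ∀ w s, s ^ 2 = w z → s ≠ 0 →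
      eval (S w s) Q * w z ^ k = eval w U + s * eval w V := by
  induction Q using MvPolynomial.induction_on with
  | C a => exact ⟨0, C a, 0, fun w s _ _ => by simp⟩
  | add p q hp hq =>
    obtain ⟨k, U, V, h⟩ := hp
    obtain ⟨k', U', V', h'⟩ := hq
    refine ⟨k + k', U * X z ^ k' + U' * X z ^ k, V * X z ^ k' + V' * X z ^ k, ?_⟩
    intro w s hs hs0
    simp only [map_add, map_mul, map_pow, eval_X]
    linear_combination w z ^ k' * h w s hs hs0 + w z ^ k * h' w s hs hs0
  | mul_X p i hp =>
    obtain ⟨k, U, V, h⟩ := hp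
    obtain ⟨k', U', V', h'⟩ := hS i
    refine ⟨k + k', U * U' + X z * V * V', U * V' + V * U', ?_⟩
    intro w s hs hs0
    simp only [map_add, map_mul, eval_X]
    linear_combination (S w s i * w z ^ k') * h w s hs hs0 +
      (eval w U + s * eval w V) * h' w s hs hs0 + eval w V * eval w V' * hs

/-- The pullback of a polynomial function of `(t, A)` along `(t, g) ↦ (t, gᵀ * g)`. -/
noncomputable def gramPullback {σ : Type*} {m : ℕ}
    (Q : MvPolynomial (σ ⊕ (Fin m × Fin m)) ℂ) : MvPolynomial (σ ⊕ (Fin m × Fin m)) ℂ :=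
  MvPolynomial.bind₁ (Sum.elim (fun x => MvPolynomial.X (Sum.inl x)) fun q =>
    ∑ k, MvPolynomial.X (Sum.inr (k, q.1)) * MvPolynomial.X (Sum.inr (k, q.2))) Q

lemma eval_gramPullback {σ : Type*} {m : ℕ} (Q : MvPolynomial (σ ⊕ (Fin m × Fin m)) ℂ)
    (t : σ → ℂ) (g : Matrix (Fin m) (Fin m) ℂ) :
    MvPolynomial.eval (matrixPoint t g) (gramPullback Q) =
      MvPolynomial.eval (matrixPoint t (gᵀ * g)) Q := by
  rw [gramPullback, MvPolynomial.eval_bind₁]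
  congr 2
  ext (x | q) <;> simp [Matrix.mul_apply]

/-- Substitution of the symmetric part of the matrix variable. -/
noncomputable def symmetrize {σ : Type*} {m : ℕ}
    (Q : MvPolynomial (σ ⊕ (Fin m × Fin m)) ℂ) : MvPolynomial (σ ⊕ (Fin m × Fin m)) ℂ :=
  MvPolynomial.bind₁ (Sum.elim (fun x => MvPolynomial.X (Sum.inl x)) fun q =>
    MvPolynomial.C (1 / 2) *
      (MvPolynomial.X (Sum.inr (q.1, q.2)) + MvPolynomial.X (Sum.inr (q.2, q.1)))) Q

lemma eval_symmetrize {σ : Type*} {m : ℕ} (Q : MvPolynomial (σ ⊕ (Fin m × Fin m)) ℂ)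
    (t : σ → ℂ) (A : Matrix (Fin m) (Fin m) ℂ) :
    MvPolynomial.eval (matrixPoint t A) (symmetrize Q) =
      MvPolynomial.eval (matrixPoint t ((1 / 2 : ℂ) • (A + Aᵀ))) Q := by
  rw [symmetrize, MvPolynomial.eval_bind₁]
  congr 2
  ext (x | q) <;> simp [mul_add]

lemma isSymm_symmetricPart {m : ℕ} (A : Matrix (Fin m) (Fin m) ℂ) :
    ((1 / 2 : ℂ) • (A + Aᵀ)).IsSymm := by
  ext i j; simp [add_comm, mul_add]

lemma symmetricPart_eq_self {m : ℕ} {A : Matrix (Fin m) (Fin m) ℂ} (hA : A.IsSymm) :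
    (1 / 2 : ℂ) • (A + Aᵀ) = A := by
  rw [hA.eq, ← two_smul ℂ A, smul_smul]; norm_num

/-- A denominator given by the squared length of the first column can be cleared. -/
lemma exists_eval_gram_of_mul_pow {σ : Type*} {m : ℕ}
    (φ : MvPolynomial (σ ⊕ (Fin (m + 1) × Fin (m + 1))) ℂ) (k : ℕ)
    (U : MvPolynomial (σ ⊕ (Fin (m + 1) × Fin (m + 1))) ℂ)
    (h : ∀ t g, MvPolynomial.eval (matrixPoint t g) φ * (gᵀ * g) 0 0 ^ k =
      MvPolynomial.eval (matrixPoint t (gᵀ * g)) U) :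
    ∃ Q : MvPolynomial (σ ⊕ (Fin (m + 1) × Fin (m + 1))) ℂ,
      ∀ t g, MvPolynomial.eval (matrixPoint t g) φ =
        MvPolynomial.eval (matrixPoint t (gᵀ * g)) Q := by
  induction k generalizing U with
  | zero => exact ⟨U, by simpa using h⟩
  | succ k ih =>
    obtain ⟨W, hW⟩ : MvPolynomial.X (Sum.inr (0, 0)) ∣ symmetrize U := by
      refine MvPolynomial.X_dvd_of_eval_eq_zero fun x hx => ?_
      obtain ⟨t, A, rfl⟩ := exists_matrixPoint_eq x
      rw [eval_symmetrize]
      obtain ⟨g, hg⟩ := (isSymm_symmetricPart A).exists_eq_transpose_mul_self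
      rw [← hg, ← h, hg]
      simp only [matrixPoint_inr] at hx
      simp [hx]
    refine ih W fun t g => ?_
    have key : φ * gramPullback (MvPolynomial.X (Sum.inr (0, 0))) ^ k = gramPullback W := by
      refine MvPolynomial.eq_of_eval_eq_of_eval_ne_zero
        (r := gramPullback (MvPolynomial.X (Sum.inr (0, 0)))) ?_ fun x hx => ?_
      · intro h0
        have := eval_gramPullback (MvPolynomial.X (Sum.inr (0, 0))) (0 : σ → ℂ)
          (1 : Matrix (Fin (m + 1)) (Fin (m + 1)) ℂ)
        rw [h0] at this
        simp at this
      · obtain ⟨t, g, rfl⟩ := exists_matrixPoint_eq x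
        refine mul_right_cancel₀ hx ?_
        simp only [map_mul, map_pow, eval_gramPullback, MvPolynomial.eval_X, matrixPoint_inr]
        rw [mul_assoc, ← pow_succ, h, ← symmetricPart_eq_self (A := gᵀ * g) (by
          simp [Matrix.IsSymm]), ← eval_symmetrize, hW]
        rw [symmetricPart_eq_self (A := gᵀ * g) (by simp [Matrix.IsSymm])]
        simp [mul_comm]
    have := congrArg (MvPolynomial.eval (matrixPoint t g)) key
    simpa [eval_gramPullback] using this


/-- The block matrix with first row `x`, and first column zero below the diagonal. -/
def consRow {m : ℕ} (x : Fin (m + 1) → ℂ) (g : Matrix (Fin m) (Fin m) ℂ) :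
    Matrix (Fin (m + 1)) (Fin (m + 1)) ℂ :=
  Matrix.of (Fin.cons x fun i => Fin.cons 0 (g i))

/-- A polynomial invariant under the left action of the orthogonal group on square matrices,
possibly depending on parameters, is a polynomial in the entries of the Gram matrix. -/
theorem exists_eval_gram_of_orthogonal_invariant (m : ℕ) {σ : Type}
    (φ : MvPolynomial (σ ⊕ (Fin m × Fin m)) ℂ)
    (hφ : ∀ h : Matrix (Fin m) (Fin m) ℂ, hᵀ * h = 1 → ∀ t g,
      MvPolynomial.eval (matrixPoint t (h * g)) φ = MvPolynomial.eval (matrixPoint t g) φ) :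
    ∃ Q : MvPolynomial (σ ⊕ (Fin m × Fin m)) ℂ,
      ∀ t g, MvPolynomial.eval (matrixPoint t g) φ =
        MvPolynomial.eval (matrixPoint t (gᵀ * g)) Q := by
  induction m generalizing σ with
  | zero =>
    refine ⟨φ, fun t g => ?_⟩
    rw [Subsingleton.elim (gᵀ * g) g]
  | succ m ih =>
    let ψ : MvPolynomial ((σ ⊕ Fin (m + 1)) ⊕ (Fin m × Fin m)) ℂ :=
      MvPolynomial.bind₁ (Sum.elim (fun x => MvPolynomial.X (Sum.inl (Sum.inl x)))
        fun q => (Fin.cons (fun j => MvPolynomial.X (Sum.inl (Sum.inr j)))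
          (fun i => Fin.cons 0 fun j => MvPolynomial.X (Sum.inr (i, j))) :
            Fin (m + 1) → Fin (m + 1) →
              MvPolynomial ((σ ⊕ Fin (m + 1)) ⊕ (Fin m × Fin m)) ℂ) q.1 q.2) φ
    have hψ : ∀ t x g, MvPolynomial.eval (matrixPoint (Sum.elim t x) g) ψ =
        MvPolynomial.eval (matrixPoint t (consRow x g)) φ := by
      intro t x g
      simp only [ψ, MvPolynomial.eval_bind₁]
      congr 2
      ext (y | ⟨i, j⟩)
      · simp
      · refine Fin.cases ?_ (fun i => ?_) i
        · simp [consRow]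
        · refine Fin.cases ?_ (fun j => ?_) j <;> simp [consRow]
    obtain ⟨Q, hQ⟩ := ih ψ fun h hh t g => by
      obtain ⟨t, x, rfl⟩ : ∃ t' x, t = Sum.elim t' x :=
        ⟨t ∘ Sum.inl, t ∘ Sum.inr, (Sum.elim_comp_inl_inr t).symm⟩
      have h1 : consRow x (h * g) = consRow (Pi.single 0 1) h * consRow x g := by
        ext i j
        rw [Matrix.mul_apply, Fin.sum_univ_succ]
        refine Fin.cases ?_ (fun i => ?_) i
        · simp [consRow]
        · refine Fin.cases ?_ (fun j => ?_) j <;> simp [consRow, Matrix.mul_apply]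
      have h2 : (consRow (Pi.single 0 1) h)ᵀ * consRow (Pi.single 0 1) h = 1 := by
        ext i j
        rw [Matrix.mul_apply, Fin.sum_univ_succ]
        refine Fin.cases ?_ (fun i => ?_) i
        · refine Fin.cases ?_ (fun j => ?_) j <;>
            simp [consRow, Fin.succ_ne_zero, (Fin.succ_ne_zero _).symm]
        · refine Fin.cases ?_ (fun j => ?_) j
          · simp [consRow]
          · have := congrFun (congrFun hh i) j
            rw [Matrix.mul_apply] at this
            simpa [consRow, Matrix.one_apply] using this
      rw [hψ, hψ, h1, hφ _ h2]
    let S : (σ ⊕ (Fin (m + 1) × Fin (m + 1)) → ℂ) → ℂ →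
        (σ ⊕ Fin (m + 1)) ⊕ (Fin m × Fin m) → ℂ := fun w s =>
      matrixPoint (Sum.elim (fun x => w (Sum.inl x))
          fun j => s * (w (Sum.inr (0, j)) / w (Sum.inr (0, 0))))
        (Matrix.of fun i j => w (Sum.inr (i.succ, j.succ)) -
          w (Sum.inr (0, i.succ)) * w (Sum.inr (0, j.succ)) / w (Sum.inr (0, 0)))
    obtain ⟨k, U, V, hUV⟩ := MvPolynomial.exists_eval_mul_pow_eq_add (Sum.inr (0, 0)) S (by
      rintro ((x | j) | ⟨i, j⟩)
      · exact ⟨0, MvPolynomial.X (Sum.inl x), 0, fun w s _ _ => by simp [S]⟩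
      · refine ⟨1, 0, MvPolynomial.X (Sum.inr (0, j)), fun w s hs hs0 => ?_⟩
        have : w (Sum.inr (0, 0)) ≠ 0 := hs ▸ pow_ne_zero 2 hs0
        simp [S]
        field_simp
      · refine ⟨1, MvPolynomial.X (Sum.inr (0, 0)) * MvPolynomial.X (Sum.inr (i.succ, j.succ)) -
          MvPolynomial.X (Sum.inr (0, i.succ)) * MvPolynomial.X (Sum.inr (0, j.succ)), 0,
          fun w s hs hs0 => ?_⟩
        have : w (Sum.inr (0, 0)) ≠ 0 := hs ▸ pow_ne_zero 2 hs0
        simp [S]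
        field_simp) Q
    -- The parity argument: replacing `s` by `-s` eliminates the odd part.
    have main : ∀ t (g : Matrix (Fin (m + 1)) (Fin (m + 1)) ℂ), IsUnit g.det →
        (gᵀ * g) 0 0 ≠ 0 → MvPolynomial.eval (matrixPoint t g) φ * (gᵀ * g) 0 0 ^ k =
          MvPolynomial.eval (matrixPoint t (gᵀ * g)) U := by
      intro t g hg h0
      set A := gᵀ * g with hA
      have hAs : A.IsSymm := by simp [hA, Matrix.IsSymm]
      have hs : ∀ s : ℂ, s ^ 2 = A 0 0 → s ≠ 0 →
          MvPolynomial.eval (matrixPoint t g) φ * A 0 0 ^ k =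
            MvPolynomial.eval (matrixPoint t A) U + s * MvPolynomial.eval (matrixPoint t A) V := by
        intro s hs hs0
        have := hUV (matrixPoint t A) s hs hs0
        rw [matrixPoint_inr] at this
        rw [← this]
        congr 1
        obtain ⟨g', hg'⟩ := Matrix.IsSymm.exists_eq_transpose_mul_self
          (A := Matrix.of fun i j : Fin m => A i.succ j.succ - A 0 i.succ * A 0 j.succ / A 0 0) (by
            ext i j
            simp [hAs.apply i.succ j.succ, mul_comm])
        have hS : S (matrixPoint t A) s =
            matrixPoint (Sum.elim t fun j => s * (A 0 j / A 0 0)) (g'ᵀ * g') := by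
          rw [hg']; rfl
        rw [hS, ← hQ, hψ]
        set M := consRow (fun j => s * (A 0 j / A 0 0)) g' with hM
        have hMA : Mᵀ * M = A := by
          ext i j
          have hg'' := fun i j => congrFun (congrFun hg' i) j
          simp only [Matrix.mul_apply, Matrix.transpose_apply, Matrix.of_apply] at hg''
          rw [Matrix.mul_apply, Fin.sum_univ_succ]
          refine Fin.cases ?_ (fun i => ?_) i
          · refine Fin.cases ?_ (fun j => ?_) j
            · simp [hM, consRow, h0, ← sq, hs]
            · simp [hM, consRow, h0]
              field_simp
              rw [hs]; field_simp
          · refine Fin.cases ?_ (fun j => ?_) j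
            · simp [hM, consRow, h0]
              rw [← hAs.apply]
              field_simp
              rw [hs]; field_simp
            · simp [hM, consRow, hg'']
              field_simp
              rw [hs]; ring
        have hMg : M = (M * g⁻¹) * g := by
          rw [Matrix.mul_assoc, Matrix.nonsing_inv_mul g hg, Matrix.mul_one]
        rw [hMg, hφ]
        rw [Matrix.transpose_mul, Matrix.mul_assoc, ← Matrix.mul_assoc Mᵀ, hMA, hA,
          Matrix.mul_assoc, Matrix.mul_nonsing_inv g hg, Matrix.mul_one,
          ← Matrix.transpose_mul, Matrix.mul_nonsing_inv g hg, Matrix.transpose_one]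
      obtain ⟨s, hs2⟩ := IsAlgClosed.exists_pow_nat_eq (A 0 0) two_pos
      have hs0 : s ≠ 0 := by
        rintro rfl
        exact h0 (by rw [← hs2]; simp)
      have h1 := hs s hs2 hs0
      have h2 := hs (-s) (by simpa using hs2) (neg_ne_zero.2 hs0)
      linear_combination (h1 + h2) / 2
    refine exists_eval_gram_of_mul_pow φ k U fun t g => ?_
    let G : Matrix (Fin (m + 1)) (Fin (m + 1))
        (MvPolynomial (σ ⊕ (Fin (m + 1) × Fin (m + 1))) ℂ) :=
      Matrix.of fun i j => MvPolynomial.X (Sum.inr (i, j))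
    have hG : ∀ t (g : Matrix (Fin (m + 1)) (Fin (m + 1)) ℂ),
        MvPolynomial.eval (matrixPoint t g) G.det = g.det := by
      intro t g
      rw [RingHom.map_det]
      congr 1
      ext i j
      simp [G]
    have key : φ * gramPullback (MvPolynomial.X (Sum.inr (0, 0))) ^ k = gramPullback U := by
      refine MvPolynomial.eq_of_eval_eq_of_eval_ne_zero
        (r := G.det * gramPullback (MvPolynomial.X (Sum.inr (0, 0)))) ?_ fun x hx => ?_
      · intro h0
        have := congrArg (MvPolynomial.eval (matrixPoint (0 : σ → ℂ)
          (1 : Matrix (Fin (m + 1)) (Fin (m + 1)) ℂ))) h0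
        rw [map_mul, hG, eval_gramPullback] at this
        simp at this
      · obtain ⟨t, g, rfl⟩ := exists_matrixPoint_eq x
        rw [map_mul, hG, eval_gramPullback, MvPolynomial.eval_X, matrixPoint_inr] at hx
        simp only [map_mul, map_pow, eval_gramPullback, MvPolynomial.eval_X, matrixPoint_inr]
        exact main t g (isUnit_iff_ne_zero.2 (left_ne_zero_of_mul hx)) (right_ne_zero_of_mul hx)
    have := congrArg (MvPolynomial.eval (matrixPoint t g)) key
    simpa [eval_gramPullback] using this

/-- A multilinear form evaluated at `g *ᵥ v i` is a polynomial in the entries of `v` and `g`. -/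
lemma MultilinearMap.exists_eval_eq_mulVec {m N : ℕ}
    (f : MultilinearMap ℂ (fun _ : Fin N => (Fin m → ℂ)) ℂ) :
    ∃ φ : MvPolynomial ((Fin N × Fin m) ⊕ (Fin m × Fin m)) ℂ,
      ∀ (v : Fin N → Fin m → ℂ) (g : Matrix (Fin m) (Fin m) ℂ),
        MvPolynomial.eval (matrixPoint (fun p => v p.1 p.2) g) φ = f fun i => g.mulVec (v i) := by
  refine ⟨∑ J : Fin N → Fin m, (∏ i, ∑ l, MvPolynomial.X (Sum.inr (J i, l)) *
    MvPolynomial.X (Sum.inl (i, l))) * MvPolynomial.C (f fun i => Pi.single (J i) 1),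
    fun v g => ?_⟩
  have h : ∀ i, g.mulVec (v i) = ∑ j, g.mulVec (v i) j • (Pi.single j 1 : Fin m → ℂ) :=
    fun i => pi_eq_sum_univ' _
  conv_rhs => rw [show (fun i => g.mulVec (v i)) = _ from funext h, f.map_sum]
  simp only [f.map_smul_univ]
  simp [Matrix.mulVec, dotProduct]

/-- The purely even case of Theorem 3.4: an `O(m,ℂ)`-invariant multilinear form `f` on
`N` copies of `ℂ^m` (`N` even) extends to a polynomial function
`F(v₁, …, v_N, A)` on `(ℂ^m)^N × M_m(ℂ)` such that `f(v) = F(v, 1)` and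
`F(g·v₁, …, g·v_N, A) = F(v₁, …, v_N, gᵀAg)` for all `g ∈ GL_m(ℂ)`. -/
theorem invariant_extends_to_space_of_forms (m N : ℕ) (hm : 0 < m) (hN : 0 < N)
    (hNeven : Even N)
    (f : MultilinearMap ℂ (fun _ : Fin N => (Fin m → ℂ)) ℂ)
    (hf : ∀ g : Matrix (Fin m) (Fin m) ℂ, gᵀ * g = 1 →
      ∀ v : Fin N → Fin m → ℂ, f (fun i => g.mulVec (v i)) = f v) :
    ∃ P : MvPolynomial ((Fin N × Fin m) ⊕ (Fin m × Fin m)) ℂ,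
      (∀ v : Fin N → Fin m → ℂ,
        f v = MvPolynomial.eval
          (Sum.elim (fun p : Fin N × Fin m => v p.1 p.2)
            (fun q : Fin m × Fin m => (1 : Matrix (Fin m) (Fin m) ℂ) q.1 q.2)) P) ∧
      (∀ g : Matrix (Fin m) (Fin m) ℂ, IsUnit g →
        ∀ (A : Matrix (Fin m) (Fin m) ℂ) (v : Fin N → Fin m → ℂ),
          MvPolynomial.eval
            (Sum.elim (fun p : Fin N × Fin m => g.mulVec (v p.1) p.2)
              (fun q : Fin m × Fin m => A q.1 q.2)) P =
          MvPolynomial.eval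
            (Sum.elim (fun p : Fin N × Fin m => v p.1 p.2)
              (fun q : Fin m × Fin m => (gᵀ * A * g) q.1 q.2)) P) := by
  obtain ⟨φ, hφ⟩ := f.exists_eval_eq_mulVec
  obtain ⟨Q, hQ⟩ := exists_eval_gram_of_orthogonal_invariant m φ fun h hh t g => by
    have h1 := hφ (fun i j => t (i, j))
    simp only [Prod.mk.eta] at h1
    rw [h1, h1]
    simp only [← Matrix.mulVec_mulVec]
    exact hf h hh _
  have hQf : ∀ (v : Fin N → Fin m → ℂ) (g : Matrix (Fin m) (Fin m) ℂ),
      MvPolynomial.eval (matrixPoint (fun p => v p.1 p.2) (gᵀ * g)) Q =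
        f fun i => g.mulVec (v i) := fun v g => by rw [← hQ, hφ]
  refine ⟨symmetrize Q, fun v => ?_, fun g _ A v => ?_⟩
  · have h1 := eval_symmetrize Q (fun p => v p.1 p.2) (1 : Matrix (Fin m) (Fin m) ℂ)
    rw [symmetricPart_eq_self Matrix.isSymm_one] at h1
    have h2 := hQf v 1
    simp only [Matrix.transpose_one, Matrix.mul_one, Matrix.one_mulVec] at h2
    exact (h1.trans h2).symm
  · obtain ⟨h, hh⟩ := (isSymm_symmetricPart A).exists_eq_transpose_mul_self
    refine (eval_symmetrize Q (fun p => g.mulVec (v p.1) p.2) A).trans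
      (Eq.trans ?_ (eval_symmetrize Q (fun p => v p.1 p.2) (gᵀ * A * g)).symm)
    have hB : (1 / 2 : ℂ) • (gᵀ * A * g + (gᵀ * A * g)ᵀ) = (h * g)ᵀ * (h * g) := by
      rw [Matrix.transpose_mul h g, Matrix.mul_assoc gᵀ hᵀ, ← Matrix.mul_assoc hᵀ, hh]
      simp only [Matrix.transpose_mul, Matrix.transpose_transpose, Matrix.mul_assoc,
        Matrix.smul_mul, Matrix.mul_smul, Matrix.add_mul, Matrix.mul_add]
    rw [hB, ← hh, hQf (fun i => g.mulVec (v i)) h, hQf]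
    simp only [Matrix.mulVec_mulVec]
end
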